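/- Let V = 2V_2 ⊕ V_4 (two quadratic forms and one quartic form) and R = O(V)^{SL(2,ℂ)}. Then R has a homogeneous system of parameters consisting of eight invariants, of degrees 2, 2, 2, 3, 3, 3, 4, 4, and the minimal number of algebra generators of R equals 19 (with 4 generators of degree 2, 4 of degree 3, 5 of degree 4, 2 of degree 5, and 4 of degree 6). Moreover, R has no homogeneous system of parameters with degrees 2, 2, 2, 2, 3, 3, 3, 4. -/

import Mathlib

open MvPolynomial

noncomputable section

namespace BinInv

/-- `k`-fold partial derivative with respect to the variable `v`. -/
def pd {A : Type*} [CommSemiring A] (v : Fin 2) (k : ℕ)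
    (f : MvPolynomial (Fin 2) A) : MvPolynomial (Fin 2) A :=
  (fun g => MvPolynomial.pderiv v g)^[k] f

/-- The `p`-th transvectant of binary forms `g`, `h` of degrees `m`, `n`,
with coefficients in a commutative `ℂ`-algebra `A`. -/
def transvectant {A : Type*} [CommRing A] [Algebra ℂ A] (m n p : ℕ)
    (g h : MvPolynomial (Fin 2) A) : MvPolynomial (Fin 2) A :=
  algebraMap ℂ (MvPolynomial (Fin 2) A)
      ((((m - p).factorial * (n - p).factorial : ℕ) : ℂ) /
        (((m.factorial * n.factorial : ℕ)) : ℂ)) *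
    ∑ i ∈ Finset.range (p + 1),
      algebraMap ℂ (MvPolynomial (Fin 2) A) ((-1 : ℂ) ^ i * (p.choose i : ℂ)) *
        (pd 0 (p - i) (pd 1 i g) * pd 0 i (pd 1 (p - i) h))

variable {p : ℕ}

/-- Index type for the coefficients of a system of binary forms of degrees `n 0, …, n (p-1)`:
the space `V = V_{n 0} ⊕ … ⊕ V_{n (p-1)}` is identified with `Idx n → ℂ`. -/
abbrev Idx (n : Fin p → ℕ) : Type := Σ i : Fin p, Fin (n i + 1)

/-- The binary form of degree `n i` with coefficient vector `c`. -/
def formAt (n : Fin p → ℕ) (c : Idx n → ℂ) (i : Fin p) : MvPolynomial (Fin 2) ℂ :=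
  ∑ k : Fin (n i + 1), C (c ⟨i, k⟩) * X 0 ^ (n i - (k : ℕ)) * X 1 ^ (k : ℕ)

/-- The substitution action of `SL(2,ℂ)` on binary forms: `(g • f)(v) = f (g⁻¹ • v)`. -/
def sl2Act (g : Matrix.SpecialLinearGroup (Fin 2) ℂ) (f : MvPolynomial (Fin 2) ℂ) :
    MvPolynomial (Fin 2) ℂ :=
  aeval (fun i => ∑ j, C ((↑(g⁻¹) : Matrix (Fin 2) (Fin 2) ℂ) i j) * X j) f

/-- The coefficient of `x^(n-k) y^k` in a binary form. -/
def coeffAt (n : Fin p → ℕ) (j : Idx n) (f : MvPolynomial (Fin 2) ℂ) : ℂ :=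
  MvPolynomial.coeff
    (Finsupp.single 0 (n j.1 - (j.2 : ℕ)) + Finsupp.single 1 (j.2 : ℕ)) f

/-- The induced action of `SL(2,ℂ)` on points of `V`, in coefficient coordinates. -/
def actPt (n : Fin p → ℕ) (g : Matrix.SpecialLinearGroup (Fin 2) ℂ) (c : Idx n → ℂ) :
    Idx n → ℂ :=
  fun j => coeffAt n j (sl2Act g (formAt n c j.1))

/-- A polynomial function on `V` is invariant if it is constant on `SL(2,ℂ)`-orbits. -/
def IsInvariant (n : Fin p → ℕ) (P : MvPolynomial (Idx n) ℂ) : Prop :=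
  ∀ (g : Matrix.SpecialLinearGroup (Fin 2) ℂ) (c : Idx n → ℂ),
    eval (actPt n g c) P = eval c P

/-- The invariant ring `R = O(V)^{SL(2,ℂ)}` as a subalgebra of `O(V)`. -/
def invariantRing (n : Fin p → ℕ) : Subalgebra ℂ (MvPolynomial (Idx n) ℂ) where
  carrier := {P | IsInvariant n P}
  mul_mem' := fun ha hb g c => by
    simp only [map_mul]; rw [ha g c, hb g c]
  one_mem' := fun g c => by simp
  add_mem' := fun ha hb g c => by
    simp only [map_add]; rw [ha g c, hb g c]
  zero_mem' := fun g c => by simp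
  algebraMap_mem' := fun r g c => by simp

/-- The nullcone: the points of `V` where every homogeneous invariant of positive
degree vanishes. -/
def Nullcone (n : Fin p → ℕ) : Set (Idx n → ℂ) :=
  {c | ∀ P ∈ invariantRing n, ∀ d : ℕ, 0 < d → P.IsHomogeneous d → eval c P = 0}

/-- `P` is a homogeneous system of parameters of the invariant ring, with degrees `d`:
the `P j` are homogeneous invariants of positive degrees `d j`, algebraically independent
over `ℂ`, and the invariant ring is integral over the subalgebra they generate. -/
def IsHSOP (n : Fin p → ℕ) {k : ℕ} (P : Fin k → MvPolynomial (Idx n) ℂ)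
    (d : Fin k → ℕ) : Prop :=
  (∀ j, P j ∈ invariantRing n) ∧ (∀ j, 0 < d j) ∧
    (∀ j, (P j).IsHomogeneous (d j)) ∧ AlgebraicIndependent ℂ P ∧
    ∀ x ∈ invariantRing n, IsIntegral (↥(Algebra.adjoin ℂ (Set.range P))) x

/-- `r` is the minimal number of generators of the invariant ring. -/
def IsMinimalNumGens (n : Fin p → ℕ) (r : ℕ) : Prop :=
  IsLeast {k | ∃ S : Finset (MvPolynomial (Idx n) ℂ),
    S.card = k ∧ Algebra.adjoin ℂ (S : Set (MvPolynomial (Idx n) ℂ)) = invariantRing n} r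

/-- The invariant ring has minimal number of generators `r`, realized by a minimal
system of homogeneous generators of degrees `d 0, …, d (r-1)`. -/
def HasMinimalGens (n : Fin p → ℕ) {r : ℕ} (d : Fin r → ℕ) : Prop :=
  IsMinimalNumGens n r ∧
    ∃ G : Fin r → MvPolynomial (Idx n) ℂ, Function.Injective G ∧
      (∀ j, (G j).IsHomogeneous (d j)) ∧
      Algebra.adjoin ℂ (Set.range G) = invariantRing n

/-- The generic binary form of degree `n i`, whose coefficients are the corresponding
coordinate functions on `V`. -/
def genForm (n : Fin p → ℕ) (i : Fin p) :
    MvPolynomial (Fin 2) (MvPolynomial (Idx n) ℂ) :=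
  ∑ k : Fin (n i + 1), C (X ⟨i, k⟩) * X 0 ^ (n i - (k : ℕ)) * X 1 ^ (k : ℕ)

end BinInv

end

noncomputable section

namespace BinInv

section Formulas

variable {K L : Type*} [CommRing K] [CommRing L]

/-- The polarised discriminant of binary quadratic forms. -/
def polarDisc (u v : Fin 3 → K) : K := u 1 * v 1 - 2 * u 0 * v 2 - 2 * u 2 * v 0

/-- The (scaled) second transvectant of a quartic and a quadratic form. -/
def quarticOp (s : Fin 5 → K) (u : Fin 3 → K) : Fin 3 → K :=
  ![12 * s 0 * u 2 - 3 * s 1 * u 1 + 2 * s 2 * u 0,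
    6 * s 1 * u 2 - 4 * s 2 * u 1 + 6 * s 3 * u 0,
    2 * s 2 * u 2 - 3 * s 3 * u 1 + 12 * s 4 * u 0]

/-- The determinant of three quadratic forms. -/
def tripleDet (u v w : Fin 3 → K) : K :=
  u 0 * (v 1 * w 2 - v 2 * w 1) - u 1 * (v 0 * w 2 - v 2 * w 0) + u 2 * (v 0 * w 1 - v 1 * w 0)

/-- The quadratic invariant of a quartic. -/
def quarticI (s : Fin 5 → K) : K := 12 * s 0 * s 4 - 3 * s 1 * s 3 + s 2 ^ 2

/-- The cubic invariant of a quartic. -/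
def quarticJ (s : Fin 5 → K) : K :=
  tripleDet (quarticOp s ![1, 0, 0]) (quarticOp s ![0, 1, 0]) (quarticOp s ![0, 0, 1])

/-- The basic invariants of two quadratic forms and a quartic form. -/
def basicInv (u v : Fin 3 → K) (s : Fin 5 → K) : Fin 19 → K :=
  ![polarDisc u u, polarDisc u v, polarDisc v v, quarticI s,
    quarticJ s, polarDisc u (quarticOp s u), polarDisc u (quarticOp s v),
    polarDisc v (quarticOp s v),
    polarDisc (quarticOp s u) (quarticOp s u), polarDisc (quarticOp s u) (quarticOp s v),
    polarDisc (quarticOp s v) (quarticOp s v),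
    tripleDet u v (quarticOp s u), tripleDet u v (quarticOp s v),
    tripleDet u v (quarticOp s (quarticOp s u)), tripleDet u v (quarticOp s (quarticOp s v)),
    tripleDet u (quarticOp s u) (quarticOp s (quarticOp s u)),
    tripleDet v (quarticOp s u) (quarticOp s (quarticOp s u)),
    tripleDet u (quarticOp s v) (quarticOp s (quarticOp s v)),
    tripleDet v (quarticOp s v) (quarticOp s (quarticOp s v))]

lemma map_polarDisc (φ : K →+* L) (u v : Fin 3 → K) :
    φ (polarDisc u v) = polarDisc (fun k => φ (u k)) (fun k => φ (v k)) := by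
  simp [polarDisc, map_ofNat φ 2]

lemma map_quarticOp (φ : K →+* L) (s : Fin 5 → K) (u : Fin 3 → K) :
    (fun k => φ (quarticOp s u k)) = quarticOp (fun k => φ (s k)) (fun k => φ (u k)) := by
  funext k; fin_cases k <;>
    simp [quarticOp, map_ofNat φ 2, map_ofNat φ 3, map_ofNat φ 4, map_ofNat φ 6, map_ofNat φ 12]

lemma map_tripleDet (φ : K →+* L) (u v w : Fin 3 → K) :
    φ (tripleDet u v w) =
      tripleDet (fun k => φ (u k)) (fun k => φ (v k)) (fun k => φ (w k)) := by
  simp [tripleDet]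

lemma map_quarticI (φ : K →+* L) (s : Fin 5 → K) :
    φ (quarticI s) = quarticI (fun k => φ (s k)) := by
  simp [quarticI, map_ofNat φ 3, map_ofNat φ 12]

lemma map_quarticJ (φ : K →+* L) (s : Fin 5 → K) :
    φ (quarticJ s) = quarticJ (fun k => φ (s k)) := by
  simp [quarticJ, tripleDet, quarticOp, map_ofNat φ 2, map_ofNat φ 3, map_ofNat φ 4,
    map_ofNat φ 6, map_ofNat φ 12]

lemma map_basicInv (φ : K →+* L) (u v : Fin 3 → K) (s : Fin 5 → K) (i : Fin 19) :
    φ (basicInv u v s i) =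
      basicInv (fun k => φ (u k)) (fun k => φ (v k)) (fun k => φ (s k)) i := by
  fin_cases i <;>
    simp [basicInv, map_polarDisc, map_tripleDet, map_quarticOp, map_quarticI, map_quarticJ]

/-- Coefficients of the quadratic form `u` after `x ↦ a x + b y`, `y ↦ c x + d y`. -/
def substQuad (a b c d : K) (u : Fin 3 → K) : Fin 3 → K :=
  ![a ^ 2 * u 0 + a * c * u 1 + c ^ 2 * u 2,
    2 * a * b * u 0 + (a * d + b * c) * u 1 + 2 * c * d * u 2,
    b ^ 2 * u 0 + b * d * u 1 + d ^ 2 * u 2]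

/-- Coefficients of the quartic form `s` after `x ↦ a x + b y`, `y ↦ c x + d y`. -/
def substQuart (a b c d : K) (s : Fin 5 → K) : Fin 5 → K :=
  ![a ^ 4 * s 0 + a ^ 3 * c * s 1 + a ^ 2 * c ^ 2 * s 2 + a * c ^ 3 * s 3 + c ^ 4 * s 4,
    4 * a ^ 3 * b * s 0 + (a ^ 3 * d + 3 * a ^ 2 * b * c) * s 1
      + (2 * a ^ 2 * c * d + 2 * a * b * c ^ 2) * s 2
      + (3 * a * c ^ 2 * d + b * c ^ 3) * s 3 + 4 * c ^ 3 * d * s 4,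
    6 * a ^ 2 * b ^ 2 * s 0 + (3 * a ^ 2 * b * d + 3 * a * b ^ 2 * c) * s 1
      + (a ^ 2 * d ^ 2 + 4 * a * b * c * d + b ^ 2 * c ^ 2) * s 2
      + (3 * a * c * d ^ 2 + 3 * b * c ^ 2 * d) * s 3 + 6 * c ^ 2 * d ^ 2 * s 4,
    4 * a * b ^ 3 * s 0 + (3 * a * b ^ 2 * d + b ^ 3 * c) * s 1
      + (2 * a * b * d ^ 2 + 2 * b ^ 2 * c * d) * s 2
      + (a * d ^ 3 + 3 * b * c * d ^ 2) * s 3 + 4 * c * d ^ 3 * s 4,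
    b ^ 4 * s 0 + b ^ 3 * d * s 1 + b ^ 2 * d ^ 2 * s 2 + b * d ^ 3 * s 3 + d ^ 4 * s 4]

lemma polarDisc_substQuad {a b c d : K} (h : a * d - b * c = 1) (u v : Fin 3 → K) :
    polarDisc (substQuad a b c d u) (substQuad a b c d v) = polarDisc u v := by
  have : polarDisc (substQuad a b c d u) (substQuad a b c d v)
      = (a * d - b * c) ^ 2 * polarDisc u v := by
    simp [polarDisc, substQuad]; ring
  rw [this, h]; ring

lemma tripleDet_substQuad {a b c d : K} (h : a * d - b * c = 1) (u v w : Fin 3 → K) :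
    tripleDet (substQuad a b c d u) (substQuad a b c d v) (substQuad a b c d w)
      = tripleDet u v w := by
  have : tripleDet (substQuad a b c d u) (substQuad a b c d v) (substQuad a b c d w)
      = (a * d - b * c) ^ 3 * tripleDet u v w := by
    simp [tripleDet, substQuad]; ring
  rw [this, h]; ring

lemma quarticOp_substQuad {a b c d : K} (h : a * d - b * c = 1) (s : Fin 5 → K)
    (u : Fin 3 → K) :
    quarticOp (substQuart a b c d s) (substQuad a b c d u)
      = substQuad a b c d (quarticOp s u) := by
  have : quarticOp (substQuart a b c d s) (substQuad a b c d u)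
      = fun k => (a * d - b * c) ^ 2 * substQuad a b c d (quarticOp s u) k := by
    funext k
    fin_cases k <;> simp [quarticOp, substQuad, substQuart] <;> ring
  rw [this, h]; simp

lemma quarticI_substQuart {a b c d : K} (h : a * d - b * c = 1) (s : Fin 5 → K) :
    quarticI (substQuart a b c d s) = quarticI s := by
  have : quarticI (substQuart a b c d s) = (a * d - b * c) ^ 4 * quarticI s := by
    simp [quarticI, substQuart]; ring
  rw [this, h]; ring

lemma tripleDet_quarticOp (s : Fin 5 → K) (u v w : Fin 3 → K) :
    tripleDet (quarticOp s u) (quarticOp s v) (quarticOp s w)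
      = quarticJ s * tripleDet u v w := by
  simp [quarticJ, tripleDet, quarticOp]; ring

lemma quarticJ_substQuart {a b c d : K} (h : a * d - b * c = 1) (s : Fin 5 → K) :
    quarticJ (substQuart a b c d s) = quarticJ s := by
  have e := tripleDet_quarticOp (substQuart a b c d s) (substQuad a b c d ![1, 0, 0])
    (substQuad a b c d ![0, 1, 0]) (substQuad a b c d ![0, 0, 1])
  simp only [quarticOp_substQuad h, tripleDet_substQuad h] at e
  rw [tripleDet_quarticOp] at e
  simpa [tripleDet] using e.symm

lemma basicInv_subst {a b c d : K} (h : a * d - b * c = 1) (u v : Fin 3 → K) (s : Fin 5 → K)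
    (i : Fin 19) :
    basicInv (substQuad a b c d u) (substQuad a b c d v) (substQuart a b c d s) i
      = basicInv u v s i := by
  simp only [basicInv, quarticOp_substQuad h, tripleDet_substQuad h, polarDisc_substQuad h,
    quarticI_substQuart h, quarticJ_substQuart h]

/-- The Cayley–Hamilton identity for `quarticOp`. -/
lemma quarticOp_cube (s : Fin 5 → K) (u : Fin 3 → K) (k : Fin 3) :
    quarticOp s (quarticOp s (quarticOp s u)) k
      = 12 * quarticI s * quarticOp s u k + quarticJ s * u k := by
  fin_cases k <;> simp [quarticOp, quarticI, quarticJ, tripleDet] <;> ring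

end Formulas

/-- The type of forms considered: two quadratics and one quartic. -/
abbrev degs : Fin 3 → ℕ := ![2, 2, 4]

section Points

variable {K L : Type*}

/-- The point of `2V₂ ⊕ V₄` with given coefficient vectors. -/
def mkPt (u v : Fin 3 → K) (s : Fin 5 → K) : Idx degs → K
  | ⟨0, k⟩ => u k
  | ⟨1, k⟩ => v k
  | ⟨2, k⟩ => s k

lemma mkPt_eta (c : Idx degs → K) :
    mkPt (fun k : Fin 3 => c ⟨0, k⟩) (fun k : Fin 3 => c ⟨1, k⟩) (fun k : Fin 5 => c ⟨2, k⟩)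
      = c := by
  funext ⟨i, k⟩
  fin_cases i <;> rfl

lemma comp_mkPt (f : K → L) (u v : Fin 3 → K) (s : Fin 5 → K) :
    (fun j => f (mkPt u v s j))
      = mkPt (fun k => f (u k)) (fun k => f (v k)) (fun k => f (s k)) := by
  funext ⟨i, k⟩
  fin_cases i <;> rfl

end Points

lemma coeffAt_formAt {p : ℕ} (n : Fin p → ℕ) (c : Idx n → ℂ) (j : Idx n) :
    coeffAt n j (formAt n c j.1) = c j := by
  obtain ⟨i, k⟩ := j
  have hm : ∀ k' : Fin (n i + 1),
      (C (c ⟨i, k'⟩) * X 0 ^ (n i - (k' : ℕ)) * X 1 ^ (k' : ℕ) : MvPolynomial (Fin 2) ℂ)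
        = monomial (Finsupp.single 0 (n i - (k' : ℕ)) + Finsupp.single 1 (k' : ℕ))
            (c ⟨i, k'⟩) := by
    intro k'
    rw [X_pow_eq_monomial, X_pow_eq_monomial, C_mul_monomial, monomial_mul]
    simp
  simp only [coeffAt, formAt, coeff_sum, hm, coeff_monomial]
  rw [Finset.sum_eq_single k]
  · simp
  · intro k' _ hk
    rw [if_neg]
    intro h
    apply hk
    have := DFunLike.congr_fun h 1
    simp at this
    exact Fin.ext this
  · simp

lemma sl2Act_eq (g : Matrix.SpecialLinearGroup (Fin 2) ℂ) {a b c d : ℂ}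
    (ha : (↑(g⁻¹) : Matrix (Fin 2) (Fin 2) ℂ) 0 0 = a)
    (hb : (↑(g⁻¹) : Matrix (Fin 2) (Fin 2) ℂ) 0 1 = b)
    (hc : (↑(g⁻¹) : Matrix (Fin 2) (Fin 2) ℂ) 1 0 = c)
    (hd : (↑(g⁻¹) : Matrix (Fin 2) (Fin 2) ℂ) 1 1 = d) (u v : Fin 3 → ℂ) (s : Fin 5 → ℂ) :
    actPt degs g (mkPt u v s)
      = mkPt (substQuad a b c d u) (substQuad a b c d v) (substQuart a b c d s) := by
  have key : ∀ i, sl2Act g (formAt degs (mkPt u v s) i) = formAt degs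
      (mkPt (substQuad a b c d u) (substQuad a b c d v) (substQuart a b c d s)) i := by
    have hsub : sl2Act g = fun f => aeval ![C a * X 0 + C b * X 1, C c * X 0 + C d * X 1] f := by
      funext f
      rw [sl2Act]
      congr 2
      funext i
      fin_cases i
      · simp only [Fin.sum_univ_two, Fin.zero_eta, ha, hb]; rfl
      · simp only [Fin.sum_univ_two, Fin.mk_one, hc, hd]; rfl
    rw [hsub]
    have h2 : (C 2 : MvPolynomial (Fin 2) ℂ) = 2 := map_ofNat C 2
    have h3 : (C 3 : MvPolynomial (Fin 2) ℂ) = 3 := map_ofNat C 3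
    have h4 : (C 4 : MvPolynomial (Fin 2) ℂ) = 4 := map_ofNat C 4
    have h6 : (C 6 : MvPolynomial (Fin 2) ℂ) = 6 := map_ofNat C 6
    intro i
    fin_cases i
    · change aeval _ (∑ k : Fin 3, C (u k) * X 0 ^ (2 - (k : ℕ)) * X 1 ^ (k : ℕ))
        = ∑ k : Fin 3, C (substQuad a b c d u k) * X 0 ^ (2 - (k : ℕ)) * X 1 ^ (k : ℕ)
      simp [Fin.sum_univ_succ, substQuad, algebraMap_eq, h2]
      ring
    · change aeval _ (∑ k : Fin 3, C (v k) * X 0 ^ (2 - (k : ℕ)) * X 1 ^ (k : ℕ))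
        = ∑ k : Fin 3, C (substQuad a b c d v k) * X 0 ^ (2 - (k : ℕ)) * X 1 ^ (k : ℕ)
      simp [Fin.sum_univ_succ, substQuad, algebraMap_eq, h2]
      ring
    · change aeval _ (∑ k : Fin 5, C (s k) * X 0 ^ (4 - (k : ℕ)) * X 1 ^ (k : ℕ))
        = ∑ k : Fin 5, C (substQuart a b c d s k) * X 0 ^ (4 - (k : ℕ)) * X 1 ^ (k : ℕ)
      simp [Fin.sum_univ_succ, substQuart, algebraMap_eq, h2, h3, h4, h6]
      ring
  funext j
  rw [actPt, key, coeffAt_formAt]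

lemma mem_invariantRing_iff (P : MvPolynomial (Idx degs) ℂ) :
    P ∈ invariantRing degs ↔ ∀ a b c d : ℂ, a * d - b * c = 1 → ∀ u v s,
      eval (mkPt (substQuad a b c d u) (substQuad a b c d v) (substQuart a b c d s)) P
        = eval (mkPt u v s) P := by
  constructor
  · intro h a b c d hdet u v s
    let g : Matrix.SpecialLinearGroup (Fin 2) ℂ :=
      ⟨!![a, b; c, d], by simp [Matrix.det_fin_two, hdet]⟩
    rw [← sl2Act_eq g⁻¹ (a := a) (b := b) (c := c) (d := d) (by rw [inv_inv]; rfl)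
      (by rw [inv_inv]; rfl)
      (by rw [inv_inv]; rfl) (by rw [inv_inv]; rfl)]
    exact h _ _
  · intro h g c
    rw [← mkPt_eta c, sl2Act_eq g rfl rfl rfl rfl]
    apply h
    have := (g⁻¹).det_coe
    rwa [Matrix.det_fin_two] at this

/-- The basic invariants as polynomials. -/
def basicPoly (i : Fin 19) : MvPolynomial (Idx degs) ℂ :=
  basicInv (fun k : Fin 3 => X ⟨0, k⟩) (fun k : Fin 3 => X ⟨1, k⟩) (fun k : Fin 5 => X ⟨2, k⟩) i

lemma aeval_basicPoly {K : Type*} [CommRing K] [Algebra ℂ K] (u v : Fin 3 → K) (s : Fin 5 → K)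
    (i : Fin 19) : aeval (mkPt u v s) (basicPoly i) = basicInv u v s i := by
  have := map_basicInv (aeval (mkPt u v s) : MvPolynomial (Idx degs) ℂ →ₐ[ℂ] K).toRingHom
    (fun k : Fin 3 => X ⟨0, k⟩) (fun k : Fin 3 => X ⟨1, k⟩) (fun k : Fin 5 => X ⟨2, k⟩) i
  simpa only [basicPoly, AlgHom.toRingHom_eq_coe, RingHom.coe_coe, aeval_X, mkPt] using this

lemma eval_basicPoly (u v : Fin 3 → ℂ) (s : Fin 5 → ℂ)
    (i : Fin 19) : eval (mkPt u v s) (basicPoly i) = basicInv u v s i := by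
  rw [← aeval_basicPoly u v s i, aeval_eq_eval]

lemma basicPoly_mem (i : Fin 19) : basicPoly i ∈ invariantRing degs := by
  rw [mem_invariantRing_iff]
  intro a b c d h u v s
  rw [eval_basicPoly, eval_basicPoly, basicInv_subst h]

lemma eval_aeval {σ τ : Type*} (x : σ → ℂ) (f : τ → MvPolynomial σ ℂ) (p : MvPolynomial τ ℂ) :
    eval x (aeval f p) = eval (fun j => eval x (f j)) p := by
  rw [← aeval_eq_eval, ← aeval_eq_eval]
  change ((aeval x : MvPolynomial σ ℂ →ₐ[ℂ] ℂ).comp (aeval f)) p = _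
  rw [comp_aeval]

section Graded

variable {σ τ M : Type*} [AddCommMonoid M]

lemma isWeightedHomogeneous_aeval_monomial {w : σ → M} {d : τ → M} {G : τ → MvPolynomial σ ℂ}
    (hG : ∀ i, IsWeightedHomogeneous w (G i) (d i)) (β : τ →₀ ℕ) (r : ℂ) :
    IsWeightedHomogeneous w (aeval G (monomial β r)) (Finsupp.weight d β) := by
  rw [aeval_monomial, Finsupp.weight_apply, Finsupp.prod, Finsupp.sum, algebraMap_eq]
  refine IsWeightedHomogeneous.C_mul ?_ r
  exact IsWeightedHomogeneous.prod _ _ _ fun i _ => (hG i).pow _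

/-- Substituting weighted homogeneous polynomials commutes with taking components. -/
lemma weightedHomogeneousComponent_aeval {w : σ → M} {d : τ → M} {G : τ → MvPolynomial σ ℂ}
    (hG : ∀ i, IsWeightedHomogeneous w (G i) (d i)) (n : M) (Y : MvPolynomial τ ℂ) :
    weightedHomogeneousComponent w n (aeval G Y)
      = aeval G (weightedHomogeneousComponent d n Y) := by
  classical
  induction Y using MvPolynomial.induction_on' with
  | add p q hp hq => simp only [map_add, hp, hq]
  | monomial β r =>
    have h1 := isWeightedHomogeneous_aeval_monomial hG β r
    have h2 := isWeightedHomogeneous_monomial d β r rfl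
    by_cases h : Finsupp.weight d β = n
    · subst h
      rw [h1.weightedHomogeneousComponent_same, h2.weightedHomogeneousComponent_same]
    · rw [h1.weightedHomogeneousComponent_ne _ (Ne.symm h),
        h2.weightedHomogeneousComponent_ne _ (Ne.symm h), map_zero]

lemma isWeightedHomogeneous_aeval {w : σ → M} {d : τ → M} {G : τ → MvPolynomial σ ℂ}
    (hG : ∀ i, IsWeightedHomogeneous w (G i) (d i)) {n : M} {Y : MvPolynomial τ ℂ}
    (hY : IsWeightedHomogeneous d Y n) : IsWeightedHomogeneous w (aeval G Y) n := by
  rw [← hY.weightedHomogeneousComponent_same, ← weightedHomogeneousComponent_aeval (w := w) hG]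
  exact weightedHomogeneousComponent_isWeightedHomogeneous _ _

/-- Multiplication by a homogeneous polynomial shifts components. -/
lemma weightedHomogeneousComponent_mul_left [IsCancelAdd M] {w : σ → M} {D : MvPolynomial σ ℂ}
    {d : M} (hD : IsWeightedHomogeneous w D d) (n : M) (Q : MvPolynomial σ ℂ) :
    weightedHomogeneousComponent w (d + n) (D * Q)
      = D * weightedHomogeneousComponent w n Q := by
  induction Q using MvPolynomial.induction_on' with
  | add p q hp hq => simp only [map_add, mul_add, hp, hq]
  | monomial β r =>
    have h2 := isWeightedHomogeneous_monomial w β r rfl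
    have h1 := hD.mul h2
    by_cases h : Finsupp.weight w β = n
    · subst h
      rw [h1.weightedHomogeneousComponent_same, h2.weightedHomogeneousComponent_same]
    · rw [h1.weightedHomogeneousComponent_ne _ (fun e => h (add_left_cancel e).symm),
        h2.weightedHomogeneousComponent_ne _ (Ne.symm h), mul_zero]

lemma eq_zero_of_weightedHomogeneousComponent {w : σ → M} {Q : MvPolynomial σ ℂ}
    (h : ∀ n, weightedHomogeneousComponent w n Q = 0) : Q = 0 := by
  classical
  ext β
  have := congrArg (coeff β) (h (Finsupp.weight w β))
  rwa [coeff_weightedHomogeneousComponent, if_pos rfl] at this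

/-- A cofactor of a homogeneous polynomial in a homogeneous polynomial is homogeneous. -/
lemma exists_weight_of_mul [IsCancelAdd M] {w : σ → M} {D Q : MvPolynomial σ ℂ}
    {d n : M} (hD : IsWeightedHomogeneous w D d) (hD0 : D ≠ 0) (hQ0 : Q ≠ 0)
    (h : IsWeightedHomogeneous w (D * Q) n) :
    ∃ m, n = d + m ∧ IsWeightedHomogeneous w Q m := by
  have hz : ∀ m, d + m ≠ n → weightedHomogeneousComponent w m Q = 0 := by
    intro m hm
    have h1 := h.weightedHomogeneousComponent_ne _ hm
    rw [weightedHomogeneousComponent_mul_left hD] at h1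
    exact (mul_eq_zero.mp h1).resolve_left hD0
  have hex : ∃ m, weightedHomogeneousComponent w m Q ≠ 0 := by
    by_contra! hall
    exact hQ0 (eq_zero_of_weightedHomogeneousComponent hall)
  obtain ⟨m, hm⟩ := hex
  have hmn : d + m = n := by
    by_contra hne
    exact hm (hz m hne)
  refine ⟨m, hmn.symm, ?_⟩
  have : Q = weightedHomogeneousComponent w m Q := by
    rw [← sub_eq_zero]
    refine eq_zero_of_weightedHomogeneousComponent (w := w) fun k => ?_
    rw [map_sub]
    by_cases hk : k = m
    · subst hk
      rw [(weightedHomogeneousComponent_isWeightedHomogeneous k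
        Q).weightedHomogeneousComponent_same, sub_self]
    · rw [(weightedHomogeneousComponent_isWeightedHomogeneous m
        Q).weightedHomogeneousComponent_ne _ hk, sub_zero]
      exact hz k fun e => hk (add_left_cancel (e.trans hmn.symm))
  rw [this]
  exact weightedHomogeneousComponent_isWeightedHomogeneous _ _

lemma weight_pi_apply {ι : Type*} (w : σ → ι → ℕ) (β : σ →₀ ℕ) (j : ι) :
    Finsupp.weight w β j = Finsupp.weight (fun i => w i j) β := by
  simp [Finsupp.weight_apply, Finsupp.sum, Finset.sum_apply]

lemma eval_scale_monomial (w : σ → ℕ) (t : ℂ) (x : σ → ℂ) (β : σ →₀ ℕ) (r : ℂ) :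
    eval (fun i => t ^ w i * x i) (monomial β r)
      = t ^ Finsupp.weight w β * eval x (monomial β r) := by
  simp only [eval_monomial, Finsupp.prod, mul_pow, Finset.prod_mul_distrib, ← pow_mul]
  rw [Finset.prod_pow_eq_pow_sum, Finsupp.weight_apply, Finsupp.sum]
  simp only [smul_eq_mul, mul_comm (w _)]
  ring

lemma eval_scale {w : σ → ℕ} {n : ℕ} {P : MvPolynomial σ ℂ}
    (h : IsWeightedHomogeneous w P n) (t : ℂ) (x : σ → ℂ) :
    eval (fun i => t ^ w i * x i) P = t ^ n * eval x P := by
  conv_lhs => rw [P.as_sum]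
  conv_rhs => rw [P.as_sum]
  rw [map_sum, map_sum, Finset.mul_sum]
  refine Finset.sum_congr rfl fun β hβ => ?_
  rw [eval_scale_monomial, h (mem_support_iff.mp hβ)]

lemma eval_scale_pi {ι : Type*} {w : σ → ι → ℕ} {n : ι → ℕ}
    {P : MvPolynomial σ ℂ} (h : IsWeightedHomogeneous w P n) (j : ι) (t : ℂ) (x : σ → ℂ) :
    eval (fun i => t ^ w i j * x i) P = t ^ n j * eval x P := by
  refine eval_scale (w := fun i => w i j) (n := n j) (fun β hβ => ?_) t x
  rw [← weight_pi_apply, h hβ]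

lemma weight_eq_of_eval_scale {w : σ → ℕ} {a b : ℕ} {P : MvPolynomial σ ℂ}
    (h : ∀ x, 4 ^ a * eval (fun i => 4 ^ w i * x i) P = 4 ^ b * eval x P)
    {β : σ →₀ ℕ} (hβ : coeff β P ≠ 0) : a + Finsupp.weight w β = b := by
  have key : (4 : ℂ) ^ a • aeval (fun i => C ((4 : ℂ) ^ w i) * X i : σ → MvPolynomial σ ℂ) P
      = (4 : ℂ) ^ b • P := by
    refine MvPolynomial.funext fun x => ?_
    rw [smul_eval, smul_eval, ← h x, eval_aeval]
    simp
  have hc := congrArg (coeff β) key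
  have hco : coeff β (aeval (fun i => C ((4 : ℂ) ^ w i) * X i : σ → MvPolynomial σ ℂ) P)
      = 4 ^ Finsupp.weight w β * coeff β P := by
    clear hc key hβ h
    induction P using MvPolynomial.induction_on' with
    | add p q hp hq => rw [map_add, coeff_add, coeff_add, hp, hq, mul_add]
    | monomial γ r =>
      classical
      have : aeval (fun i => C ((4 : ℂ) ^ w i) * X i : σ → MvPolynomial σ ℂ) (monomial γ r)
          = C (4 ^ Finsupp.weight w γ) * monomial γ r := by
        simp only [aeval_monomial, mul_pow, Finsupp.prod, Finset.prod_mul_distrib, ← C_pow,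
          ← pow_mul, ← map_prod]
        rw [Finset.prod_pow_eq_pow_sum, Finsupp.weight_apply, Finsupp.sum, algebraMap_eq,
          monomial_eq (s := γ) (a := r), Finsupp.prod]
        simp only [smul_eq_mul, mul_comm (w _)]
        ring
      rw [this, coeff_C_mul, coeff_monomial]
      split_ifs with hγ
      · rw [hγ]
      · simp
  rw [coeff_smul, coeff_smul, hco, smul_eq_mul, smul_eq_mul, ← mul_assoc, ← pow_add] at hc
  have := mul_right_cancel₀ hβ hc
  have h4 : (4 : ℕ) ^ (a + Finsupp.weight w β) = 4 ^ b := by exact_mod_cast this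
  exact Nat.pow_right_injective (le_refl 2 |>.trans (by norm_num)) h4

lemma isWeightedHomogeneous_of_eval_scale {ι : Type*} {w : σ → ι → ℕ} {n : ι → ℕ}
    {P : MvPolynomial σ ℂ}
    (h : ∀ j, ∃ a, ∀ x, 4 ^ a * eval (fun i => 4 ^ w i j * x i) P = 4 ^ (a + n j) * eval x P) :
    IsWeightedHomogeneous w P n := by
  intro β hβ
  funext j
  obtain ⟨a, ha⟩ := h j
  have := weight_eq_of_eval_scale ha hβ
  rw [weight_pi_apply]
  omega

end Graded

section Divisibility

variable {σ : Type*}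

lemma X_dvd_sub_aeval_update [DecidableEq σ] (i : σ) (p : MvPolynomial σ ℂ) :
    X i ∣ p - aeval (Function.update X i (0 : MvPolynomial σ ℂ)) p := by
  rw [← Ideal.mem_span_singleton, ← Ideal.Quotient.mk_eq_mk_iff_sub_mem]
  have : (Ideal.Quotient.mkₐ ℂ (Ideal.span {(X i : MvPolynomial σ ℂ)}))
      = (Ideal.Quotient.mkₐ ℂ (Ideal.span {(X i : MvPolynomial σ ℂ)})).comp
          (aeval (Function.update X i (0 : MvPolynomial σ ℂ))) := by
    refine algHom_ext fun j => ?_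
    by_cases h : j = i
    · subst h
      simp
    · simp [h]
  exact DFunLike.congr_fun this p

/-- A polynomial vanishing on a dense part of the hyperplane `x i = 0` is divisible by `X i`. -/
lemma X_dvd_of_eval {i j : σ} (hij : j ≠ i) {p : MvPolynomial σ ℂ}
    (h : ∀ x : σ → ℂ, x i = 0 → x j ≠ 0 → eval x p = 0) : X i ∣ p := by
  classical
  have h0 : aeval (Function.update X i (0 : MvPolynomial σ ℂ)) p = 0 := by
    have : X j * aeval (Function.update X i (0 : MvPolynomial σ ℂ)) p = 0 := by
      refine MvPolynomial.funext fun x => ?_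
      rw [eval_mul, eval_X, map_zero, mul_eq_zero, or_iff_not_imp_left]
      intro hx
      rw [eval_aeval]
      refine h _ (by simp) ?_
      simpa [hij] using hx
    exact (mul_eq_zero.mp this).resolve_left (X_ne_zero _)
  have := X_dvd_sub_aeval_update i p
  rwa [h0, sub_zero] at this

/-- A polynomial vanishing at the squares `(a², 2ab, b²)` is divisible by the discriminant. -/
lemma polarDisc_dvd_of_eval {i j k : σ} (hij : j ≠ i) (hjk : k ≠ j)
    {p : MvPolynomial σ ℂ}
    (h : ∀ x : σ → ℂ, x i ≠ 0 → x j ^ 2 = 4 * x i * x k → eval x p = 0) :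
    X j ^ 2 - 4 * X i * X k ∣ p := by
  classical
  set D : MvPolynomial σ ℂ := X j ^ 2 - 4 * X i * X k with hD
  let κ : MvPolynomial σ ℂ →ₐ[ℂ] MvPolynomial σ ℂ :=
    aeval (Function.update X j (0 : MvPolynomial σ ℂ))
  have hred : ∀ p : MvPolynomial σ ℂ, ∃ A B, D ∣ p - (κ A + X j * κ B) := by
    intro p
    induction p using MvPolynomial.induction_on with
    | C a => exact ⟨C a, 0, by simp [κ, algebraMap_eq]⟩
    | add p q hp hq =>
      obtain ⟨A, B, h1⟩ := hp
      obtain ⟨A', B', h2⟩ := hq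
      refine ⟨A + A', B + B', ?_⟩
      have := dvd_add h1 h2
      rw [map_add, map_add]
      convert this using 1
      ring
    | mul_X p l hp =>
      obtain ⟨A, B, h1⟩ := hp
      by_cases hl : l = j
      · subst hl
        refine ⟨4 * X i * X k * B, A, ?_⟩
        have h3 : κ (4 * X i * X k * B) = 4 * X i * X k * κ B := by
          simp [κ, hij.symm, hjk, map_ofNat]
        rw [h3]
        have := dvd_add (dvd_mul_of_dvd_left h1 (X l)) (Dvd.intro (κ B) rfl : D ∣ D * κ B)
        convert this using 1
        rw [hD]; ring
      · refine ⟨A * X l, B * X l, ?_⟩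
        have h3 : κ (X l) = X l := by simp [κ, hl]
        rw [map_mul, map_mul, h3]
        have := dvd_mul_of_dvd_left h1 (X l)
        convert this using 1
        ring
  obtain ⟨A, B, hAB⟩ := hred p
  have hκ : ∀ (x : σ → ℂ) (r : ℂ) (q : MvPolynomial σ ℂ),
      eval (Function.update x j r) (κ q) = eval x (κ q) := by
    intro x r q
    simp only [κ, eval_aeval]
    congr 2
    funext l
    by_cases hl : l = j
    · subst hl; simp
    · simp [hl]
  have hv : ∀ x : σ → ℂ, x i ≠ 0 → x k ≠ 0 → eval x (κ A) = 0 ∧ eval x (κ B) = 0 := by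
    intro x hi hk
    obtain ⟨r, hr⟩ := IsAlgClosed.exists_pow_nat_eq (4 * x i * x k) (n := 2) (by norm_num)
    have hr0 : r ≠ 0 := by
      rintro rfl
      have : 4 * x i * x k = 0 := by rw [← hr]; ring
      simp [hi, hk] at this
    have hp : ∀ t : ℂ, t ^ 2 = 4 * x i * x k → eval x (κ A) + t * eval x (κ B) = 0 := by
      intro t ht
      obtain ⟨W, hW⟩ := hAB
      have h1 := congrArg (eval (Function.update x j t)) hW
      rw [eval_sub, eval_add, eval_mul, eval_mul, hκ, hκ, eval_X, hD,
        h _ (by simpa [hij.symm] using hi) (by simp [hij.symm, hjk, ht])] at h1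
      simp [hij.symm, hjk, ht] at h1
      linear_combination -h1
    have h1 := hp r hr
    have h2 := hp (-r) (by rw [neg_sq, hr])
    refine ⟨by linear_combination (h1 + h2) / 2, ?_⟩
    have : r * eval x (κ B) = 0 := by linear_combination (h1 - h2) / 2
    exact (mul_eq_zero.mp this).resolve_left hr0
  have hz : ∀ q : MvPolynomial σ ℂ, (∀ x : σ → ℂ, x i ≠ 0 → x k ≠ 0 → eval x q = 0) → q = 0 := by
    intro q hq
    have : X i * X k * q = 0 := by
      refine MvPolynomial.funext fun x => ?_
      rw [eval_mul, eval_mul, eval_X, eval_X, map_zero, mul_eq_zero, or_iff_not_imp_left,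
        mul_eq_zero, not_or]
      exact fun hx => hq x hx.1 hx.2
    exact (mul_eq_zero.mp this).resolve_left (mul_ne_zero (X_ne_zero _) (X_ne_zero _))
  rw [hz _ fun x hi hk => (hv x hi hk).1, hz _ fun x hi hk => (hv x hi hk).2] at hAB
  simpa using hAB

lemma aeval_cofactor {D Q : MvPolynomial σ ℂ} (hD0 : D ≠ 0) (g : σ → MvPolynomial σ ℂ)
    (hD : aeval g D = D) (h : aeval g (D * Q) = D * Q) : aeval g Q = Q := by
  rw [map_mul, hD] at h
  exact mul_left_cancel₀ hD0 h

end Divisibility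

section Seeds

variable {K L : Type*} [CommRing K] [CommRing L]

/-- The square `y²` as a coefficient vector. -/
def ySq : Fin 3 → K := ![0, 0, 1]

/-- Leading coefficients of covariants of a quartic: the form itself, its Hessian, `I`, `J`. -/
def seed (s : Fin 5 → K) : Fin 4 → K :=
  ![s 0, polarDisc (quarticOp s ySq) (quarticOp s ySq), quarticI s, quarticJ s]

/-- Leading coefficient of the sextic covariant of a quartic. -/
def seedT (s : Fin 5 → K) : K := tripleDet ySq (quarticOp s ySq) (quarticOp s (quarticOp s ySq))

lemma map_ySq (φ : K →+* L) : (fun k => φ (ySq k)) = ySq := by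
  funext k; fin_cases k <;> simp [ySq]

lemma map_seed (φ : K →+* L) (s : Fin 5 → K) (i : Fin 4) :
    φ (seed s i) = seed (fun k => φ (s k)) i := by
  fin_cases i <;> simp [seed, map_polarDisc, map_quarticOp, map_ySq, map_quarticI, map_quarticJ]

lemma map_seedT (φ : K →+* L) (s : Fin 5 → K) : φ (seedT s) = seedT (fun k => φ (s k)) := by
  simp [seedT, map_tripleDet, map_quarticOp, map_ySq]

lemma seedT_sq (s : Fin 5 → K) :
    4 * seedT s ^ 2 = seed s 1 ^ 3 - 12 * seed s 2 * (-24 * seed s 0) ^ 2 * seed s 1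
      + seed s 3 * (-24 * seed s 0) ^ 3 := by
  simp [seed, seedT, polarDisc, quarticOp, ySq, tripleDet, quarticI, quarticJ]; ring

lemma substQuad_ySq (b : K) : substQuad 1 b 0 1 ySq = ySq := by
  funext k; fin_cases k <;> simp [substQuad, ySq]

lemma seed_subst (b : K) (s : Fin 5 → K) (i : Fin 4) :
    seed (substQuart 1 b 0 1 s) i = seed s i := by
  have h : (1 : K) * 1 - b * 0 = 1 := by ring
  have h1 := quarticOp_substQuad h s ySq
  rw [substQuad_ySq] at h1
  fin_cases i
  · simp [seed, substQuart]
  · simp [seed, h1, polarDisc_substQuad h]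
  · simp [seed, quarticI_substQuart h]
  · simp [seed, quarticJ_substQuart h]

lemma seedT_subst (b : K) (s : Fin 5 → K) : seedT (substQuart 1 b 0 1 s) = seedT s := by
  have h : (1 : K) * 1 - b * 0 = 1 := by ring
  have h1 := quarticOp_substQuad h s ySq
  rw [substQuad_ySq] at h1
  have h2 := tripleDet_substQuad h ySq (quarticOp s ySq) (quarticOp s (quarticOp s ySq))
  rw [substQuad_ySq] at h2
  rw [seedT, h1, quarticOp_substQuad h, h2, seedT]

end Seeds

/-- The polynomials `seed`. -/
def seedPoly (i : Fin 4) : MvPolynomial (Fin 5) ℂ := seed X i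

/-- The polynomial `seedT`. -/
def seedTPoly : MvPolynomial (Fin 5) ℂ := seedT X

lemma eval_seedPoly (s : Fin 5 → ℂ) (i : Fin 4) : eval s (seedPoly i) = seed s i := by
  rw [seedPoly, map_seed]; simp

lemma eval_seedTPoly (s : Fin 5 → ℂ) : eval s seedTPoly = seedT s := by
  rw [seedTPoly, map_seedT]; simp

/-- Polynomials of the form `p₀ + T p₁` with `p₀`, `p₁` polynomials in the seeds. -/
def IsSeedNormal (c : MvPolynomial (Fin 5) ℂ) : Prop :=
  ∃ p q : MvPolynomial (Fin 4) ℂ, c = aeval seedPoly p + seedTPoly * aeval seedPoly q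

lemma seedTPoly_sq : seedTPoly ^ 2 = aeval seedPoly (C (1 / 4) *
    (X 1 ^ 3 - 12 * X 2 * (-24 * X 0) ^ 2 * X 1 + X 3 * (-24 * X 0) ^ 3) :
      MvPolynomial (Fin 4) ℂ) := by
  refine MvPolynomial.funext fun s => ?_
  rw [eval_pow, eval_seedTPoly, eval_aeval]
  simp only [eval_seedPoly, map_mul, map_add, map_sub, map_pow, map_neg, eval_C, eval_X]
  have h := seedT_sq s
  simp only [map_ofNat]
  linear_combination h / 4

lemma isSeedNormal_aeval (Y : MvPolynomial (Fin 4 ⊕ Unit) ℂ) :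
    IsSeedNormal (aeval (Sum.elim seedPoly fun _ => seedTPoly) Y) := by
  induction Y using MvPolynomial.induction_on with
  | C a => exact ⟨C a, 0, by simp⟩
  | add p q hp hq =>
    obtain ⟨p0, p1, h⟩ := hp
    obtain ⟨q0, q1, h'⟩ := hq
    exact ⟨p0 + q0, p1 + q1, by rw [map_add, h, h', map_add, map_add]; ring⟩
  | mul_X p i hp =>
    obtain ⟨p0, p1, h⟩ := hp
    rcases i with i | i
    · refine ⟨p0 * X i, p1 * X i, ?_⟩
      rw [map_mul, h, map_mul, map_mul, aeval_X, aeval_X, Sum.elim_inl]; ring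
    · refine ⟨p1 * (C (1 / 4) *
        (X 1 ^ 3 - 12 * X 2 * (-24 * X 0) ^ 2 * X 1 + X 3 * (-24 * X 0) ^ 3)), p0, ?_⟩
      rw [map_mul, h, map_mul (aeval seedPoly) p1, ← seedTPoly_sq, aeval_X, Sum.elim_inr]; ring

/-- Cancelling the leading coefficient preserves the normal form. -/
lemma IsSeedNormal.of_X_mul {c : MvPolynomial (Fin 5) ℂ} (h : IsSeedNormal (X 0 * c)) :
    IsSeedNormal c := by
  obtain ⟨p, q, h⟩ := h
  have hpq : ∀ x : Fin 4 → ℂ, x 0 = 0 → x 1 ≠ 0 → eval x p = 0 ∧ eval x q = 0 := by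
    intro x h0 h1
    obtain ⟨z, hz⟩ := IsAlgClosed.exists_pow_nat_eq (x 1 / 36) (n := 2) (by norm_num)
    have hx1 : x 1 = 36 * z ^ 2 := by rw [hz]; ring
    have hz0 : z ≠ 0 := by
      rintro rfl
      exact h1 (by rw [hx1]; ring)
    have key : ∀ w : ℂ, w ^ 2 = z ^ 2 → w ≠ 0 → eval x p + 108 * w ^ 3 * eval x q = 0 := by
      intro w hw hw0
      have e := congrArg (eval ![0, w, 0, -x 2 / (3 * w), -x 3 / (216 * w ^ 2)]) h
      have hs : (fun j => eval ![0, w, 0, -x 2 / (3 * w), -x 3 / (216 * w ^ 2)] (seedPoly j))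
          = x := by
        funext j
        rw [eval_seedPoly]
        fin_cases j
        · simp [seed, h0]
        · simp [seed, polarDisc, quarticOp, ySq, hx1, ← hw]; ring
        · simp [seed, quarticI]; field_simp
        · simp [seed, quarticJ, tripleDet, quarticOp]; field_simp; ring
      rw [eval_mul, eval_X, eval_add, eval_mul, eval_aeval, eval_aeval, hs, eval_seedTPoly] at e
      have ht : seedT ![0, w, 0, -x 2 / (3 * w), -x 3 / (216 * w ^ 2)] = 108 * w ^ 3 := by
        simp [seedT, tripleDet, quarticOp, ySq]; ring
      rw [ht] at e
      rw [← e]; simp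
    have k1 := key z rfl hz0
    have k2 := key (-z) (by ring) (neg_ne_zero.mpr hz0)
    refine ⟨by linear_combination (k1 + k2) / 2, ?_⟩
    have : z ^ 3 * eval x q = 0 := by linear_combination (k1 - k2) / 216
    exact (mul_eq_zero.mp this).resolve_left (pow_ne_zero _ hz0)
  obtain ⟨p', hp'⟩ := X_dvd_of_eval (i := 0) (j := 1) (by decide) fun x h0 h1 => (hpq x h0 h1).1
  obtain ⟨q', hq'⟩ := X_dvd_of_eval (i := 0) (j := 1) (by decide) fun x h0 h1 => (hpq x h0 h1).2
  refine ⟨p', q', ?_⟩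
  have hX : seedPoly 0 = X 0 := by simp [seedPoly, seed]
  refine mul_left_cancel₀ (X_ne_zero (0 : Fin 5)) ?_
  rw [h, hp', hq', map_mul, map_mul, aeval_X, hX]; ring

lemma exists_seed_clear (c : MvPolynomial (Fin 5) ℂ) :
    ∃ (N : ℕ) (Y : MvPolynomial (Fin 4 ⊕ Unit) ℂ), ∀ s : Fin 5 → ℂ, s 0 ≠ 0 →
      s 0 ^ N * eval ![s 0, 0, -seed s 1 / (96 * s 0), seedT s / (864 * s 0 ^ 2),
        (quarticI s - (seed s 1 / (96 * s 0)) ^ 2) / (12 * s 0)] c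
        = eval (Sum.elim (seed s) fun _ => seedT s) Y := by
  induction c using MvPolynomial.induction_on with
  | C a => exact ⟨0, C a, by simp⟩
  | add p q hp hq =>
    obtain ⟨N, Y, h⟩ := hp
    obtain ⟨N', Y', h'⟩ := hq
    refine ⟨N + N', X (Sum.inl 0) ^ N' * Y + X (Sum.inl 0) ^ N * Y', fun s hs => ?_⟩
    have e : seed s 0 = s 0 := by simp [seed]
    rw [eval_add, eval_add, eval_mul, eval_mul, eval_pow, eval_pow, eval_X, Sum.elim_inl, e,
      ← h s hs, ← h' s hs]
    ring
  | mul_X p i hp =>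
    obtain ⟨N, Y, h⟩ := hp
    refine ⟨N + 3, Y * (![X (Sum.inl 0) ^ 4, 0, C (-1 / 96) * X (Sum.inl 0) ^ 2 * X (Sum.inl 1),
      C (1 / 864) * X (Sum.inl 0) * X (Sum.inr ()),
      C (1 / 12) * (X (Sum.inl 0) ^ 2 * X (Sum.inl 2) - C (1 / 9216) * X (Sum.inl 1) ^ 2)] i),
      fun s hs => ?_⟩
    have e : seed s 0 = s 0 := by simp [seed]
    have e2 : seed s 2 = quarticI s := by simp [seed]
    rw [eval_mul, eval_mul, ← h s hs, pow_add, mul_mul_mul_comm, eval_X]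
    congr 1
    fin_cases i
    · simp [e]; ring
    · simp
    · simp [e]; field_simp
    · simp [e]; field_simp
    · simp [e, e2]; field_simp; ring

/-- The leading coefficients of covariants of a quartic are polynomials in the seeds. -/
theorem isSeedNormal_of_invariant {c : MvPolynomial (Fin 5) ℂ}
    (hc : ∀ (b : ℂ) (s : Fin 5 → ℂ), eval (substQuart 1 b 0 1 s) c = eval s c) :
    IsSeedNormal c := by
  obtain ⟨N, Y, h⟩ := exists_seed_clear c
  have key : X 0 ^ (N + 1) * c
      = aeval (Sum.elim seedPoly fun _ => seedTPoly) (X (Sum.inl 0) * Y) := by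
    refine MvPolynomial.funext fun s => ?_
    rw [eval_aeval]
    have e1 : (fun j => eval s ((Sum.elim seedPoly fun _ => seedTPoly : Fin 4 ⊕ Unit → _) j))
        = Sum.elim (seed s) fun _ => seedT s := by
      funext j
      rcases j with j | j
      · simp [eval_seedPoly]
      · simp [eval_seedTPoly]
    have e : seed s 0 = s 0 := by simp [seed]
    rw [e1, eval_mul, eval_mul, eval_pow, eval_X, eval_X, Sum.elim_inl, e]
    by_cases hs : s 0 = 0
    · simp [hs]
    · rw [← h s hs, pow_succ', mul_assoc, ← hc (-s 1 / (4 * s 0)) s]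
      congr 4
      have hI := quarticI_substQuart (a := 1) (b := -s 1 / (4 * s 0)) (c := 0) (d := 1)
        (by ring) s
      have hH := seed_subst (-s 1 / (4 * s 0)) s 1
      have hT := seedT_subst (-s 1 / (4 * s 0)) s
      have h0 : substQuart 1 (-s 1 / (4 * s 0)) 0 1 s 0 = s 0 := by simp [substQuart]
      have h1 : substQuart 1 (-s 1 / (4 * s 0)) 0 1 s 1 = 0 := by
        simp [substQuart]; field_simp; ring
      rw [← hI, ← hH, ← hT]
      generalize substQuart 1 (-s 1 / (4 * s 0)) 0 1 s = r at *
      have hr : r 0 ≠ 0 := by rwa [h0]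
      rw [← h0]
      funext k
      fin_cases k
      · simp
      · simp [h1]
      · simp [seed, polarDisc, quarticOp, ySq, h1]; field_simp; ring
      · simp [seedT, tripleDet, quarticOp, ySq, h1]; field_simp; ring
      · simp [seed, polarDisc, quarticOp, quarticI, ySq, h1]; field_simp; ring
  have hN : ∀ N, IsSeedNormal (X 0 ^ N * c) → IsSeedNormal c := by
    intro N
    induction N with
    | zero => simp
    | succ N ih =>
      intro h
      rw [pow_succ', mul_assoc] at h
      exact ih h.of_X_mul
  exact hN (N + 1) (key ▸ isSeedNormal_aeval _)

section Scaling

variable {K L : Type*} [CommRing K] [CommRing L]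

/-- Degrees of the basic invariants in the first quadratic form. -/
def degU : Fin 19 → ℕ := ![2, 1, 0, 0, 0, 2, 1, 0, 2, 1, 0, 2, 1, 2, 1, 3, 2, 1, 0]

/-- Degrees of the basic invariants in the second quadratic form. -/
def degV : Fin 19 → ℕ := ![0, 1, 2, 0, 0, 0, 1, 2, 0, 1, 2, 1, 2, 1, 2, 0, 1, 2, 3]

/-- Degrees of the basic invariants in the quartic form. -/
def degS : Fin 19 → ℕ := ![0, 0, 0, 2, 3, 1, 1, 1, 2, 2, 2, 1, 1, 2, 2, 3, 3, 3, 3]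

lemma polarDisc_scale (l m t : K) (u v : Fin 3 → K) :
    polarDisc (fun k => l * t ^ (k : ℕ) * u k) (fun k => m * t ^ (k : ℕ) * v k)
      = l * m * t ^ 2 * polarDisc u v := by
  simp [polarDisc]; ring

lemma tripleDet_scale (l m n t : K) (u v w : Fin 3 → K) :
    tripleDet (fun k => l * t ^ (k : ℕ) * u k) (fun k => m * t ^ (k : ℕ) * v k)
      (fun k => n * t ^ (k : ℕ) * w k) = l * m * n * t ^ 3 * tripleDet u v w := by
  simp [tripleDet]; ring

lemma quarticOp_scale (l n t : K) (s : Fin 5 → K) (u : Fin 3 → K) :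
    quarticOp (fun k => n * t ^ (k : ℕ) * s k) (fun k => l * t ^ (k : ℕ) * u k)
      = fun k : Fin 3 => (n * l * t ^ 2) * t ^ (k : ℕ) * quarticOp s u k := by
  funext k; fin_cases k <;> simp [quarticOp] <;> ring

lemma quarticI_scale (n t : K) (s : Fin 5 → K) :
    quarticI (fun k => n * t ^ (k : ℕ) * s k) = n ^ 2 * t ^ 4 * quarticI s := by
  simp [quarticI]; ring

lemma quarticJ_scale (n t : K) (s : Fin 5 → K) :
    quarticJ (fun k => n * t ^ (k : ℕ) * s k) = n ^ 3 * t ^ 6 * quarticJ s := by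
  simp [quarticJ, tripleDet, quarticOp]; ring

lemma basicInv_scale (l m n t : K) (u v : Fin 3 → K) (s : Fin 5 → K) (i : Fin 19) :
    basicInv (fun k => l * t ^ (k : ℕ) * u k) (fun k => m * t ^ (k : ℕ) * v k)
      (fun k => n * t ^ (k : ℕ) * s k) i
      = l ^ degU i * m ^ degV i * n ^ degS i * t ^ (degU i + degV i + 2 * degS i)
          * basicInv u v s i := by
  fin_cases i <;>
    simp [basicInv, quarticOp_scale, polarDisc_scale, tripleDet_scale, quarticI_scale,
      quarticJ_scale, degU, degV, degS] <;> ring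

/-- The basic invariants, except the first one, at `u = y²`. -/
def covBasic (v : Fin 3 → K) (s : Fin 5 → K) (j : Fin 18) : K := basicInv ySq v s j.succ

lemma map_covBasic (φ : K →+* L) (v : Fin 3 → K) (s : Fin 5 → K) (j : Fin 18) :
    φ (covBasic v s j) = covBasic (fun k => φ (v k)) (fun k => φ (s k)) j := by
  rw [covBasic, map_basicInv, map_ySq, covBasic]

/-- The square of a linear form. -/
def linSq (m : Fin 2 → K) : Fin 3 → K := ![m 0 ^ 2, 2 * m 0 * m 1, m 1 ^ 2]

lemma map_linSq (φ : K →+* L) (m : Fin 2 → K) :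
    (fun k => φ (linSq m k)) = linSq fun k => φ (m k) := by
  funext k; fin_cases k <;> simp [linSq, map_ofNat φ 2]

end Scaling

/-- Weights on the coordinates of a linear form and a quartic form. -/
def wtLin : Fin 2 ⊕ Fin 5 → Fin 3 → ℕ := Sum.elim (fun k => ![1, 0, k]) fun k => ![0, 1, k]

/-- Weights on the coordinates of a quadratic form and a quartic form. -/
def wtQuad : Fin 3 ⊕ Fin 5 → Fin 3 → ℕ := Sum.elim (fun k => ![2, 0, k]) fun k => ![0, 1, k]

/-- Weights of the polynomials `covBasic`. -/
def wtCov (j : Fin 18) : Fin 3 → ℕ :=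
  ![2 * degV j.succ, degS j.succ, degV j.succ + 2 * degS j.succ - degU j.succ]

/-- The polynomials `covBasic` on the space of a quadratic form and a quartic form. -/
def quadCov (j : Fin 18) : MvPolynomial (Fin 3 ⊕ Fin 5) ℂ :=
  covBasic (fun k => X (Sum.inl k)) (fun k => X (Sum.inr k)) j

/-- The polynomials `covBasic` on the space of a linear form and a quartic form. -/
def linCov (j : Fin 18) : MvPolynomial (Fin 2 ⊕ Fin 5) ℂ :=
  covBasic (linSq fun k => X (Sum.inl k)) (fun k => X (Sum.inr k)) j

/-- The substitution of the square of a linear form for a quadratic form. -/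
def sqSubst : Fin 3 ⊕ Fin 5 → MvPolynomial (Fin 2 ⊕ Fin 5) ℂ :=
  Sum.elim (linSq fun k => X (Sum.inl k)) fun k => X (Sum.inr k)

lemma eval_quadCov (v : Fin 3 → ℂ) (s : Fin 5 → ℂ) (j : Fin 18) :
    eval (Sum.elim v s) (quadCov j) = covBasic v s j := by
  rw [quadCov, map_covBasic]; simp

lemma eval_linCov (m : Fin 2 → ℂ) (s : Fin 5 → ℂ) (j : Fin 18) :
    eval (Sum.elim m s) (linCov j) = covBasic (linSq m) s j := by
  rw [linCov, map_covBasic, map_linSq]; simp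

lemma aeval_sqSubst_quadCov (j : Fin 18) : aeval sqSubst (quadCov j) = linCov j := by
  have := map_covBasic (aeval sqSubst : MvPolynomial (Fin 3 ⊕ Fin 5) ℂ →ₐ[ℂ]
    MvPolynomial (Fin 2 ⊕ Fin 5) ℂ).toRingHom (fun k => X (Sum.inl k))
    (fun k => X (Sum.inr k)) j
  simpa [sqSubst, quadCov, linCov] using this

lemma sqSubst_homogeneous (i : Fin 3 ⊕ Fin 5) :
    IsWeightedHomogeneous wtLin (sqSubst i) (wtQuad i) := by
  refine isWeightedHomogeneous_of_eval_scale fun j => ⟨0, fun x => ?_⟩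
  rcases i with i | i <;> fin_cases i <;> fin_cases j <;>
    simp [sqSubst, linSq, wtLin, wtQuad, map_ofNat] <;> ring

lemma quadCov_homogeneous (j : Fin 18) : IsWeightedHomogeneous wtQuad (quadCov j) (wtCov j) := by
  have hx : ∀ x : Fin 3 ⊕ Fin 5 → ℂ, x = Sum.elim (fun k => x (Sum.inl k)) fun k => x (Sum.inr k) :=
    fun x => (Sum.elim_comp_inl_inr x).symm
  have key : ∀ (l m n t : ℂ) (x : Fin 3 ⊕ Fin 5 → ℂ), l * t ^ 2 = 1 →
      eval (Sum.elim (fun k : Fin 3 => m * t ^ (k : ℕ) * x (Sum.inl k))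
        fun k : Fin 5 => n * t ^ (k : ℕ) * x (Sum.inr k)) (quadCov j)
      = l ^ degU j.succ * m ^ degV j.succ * n ^ degS j.succ
        * t ^ (degU j.succ + degV j.succ + 2 * degS j.succ) * eval x (quadCov j) := by
    intro l m n t x h
    have e : (fun k : Fin 3 => l * t ^ (k : ℕ) * ySq k) = (ySq : Fin 3 → ℂ) := by
      funext k; fin_cases k <;> simp [ySq, h]
    conv_rhs => rw [hx x]
    rw [eval_quadCov, eval_quadCov, covBasic, covBasic, ← basicInv_scale, e]
  refine isWeightedHomogeneous_of_eval_scale fun i => ⟨0, fun x => ?_⟩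
  rw [hx fun i_1 => _]
  fin_cases i
  · have := key 1 16 1 1 x (by norm_num)
    simp [wtQuad, wtCov] at this ⊢
    norm_num at this ⊢
    rw [this, pow_mul]; norm_num
  · have := key 1 1 4 1 x (by norm_num)
    simp [wtQuad, wtCov] at this ⊢
    rw [this]
  · have := key (1 / 16) 1 1 4 x (by norm_num)
    simp [wtQuad, wtCov] at this ⊢
    rw [this]
    congr 1
    fin_cases j <;> simp [degU, degV, degS] <;> norm_num

lemma linCov_homogeneous (j : Fin 18) : IsWeightedHomogeneous wtLin (linCov j) (wtCov j) := by
  rw [← aeval_sqSubst_quadCov]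
  exact isWeightedHomogeneous_aeval sqSubst_homogeneous (quadCov_homogeneous j)

/-- The algebra generated by the polynomials `linCov`. -/
def linAlg : Subalgebra ℂ (MvPolynomial (Fin 2 ⊕ Fin 5) ℂ) :=
  (aeval linCov : MvPolynomial (Fin 18) ℂ →ₐ[ℂ] MvPolynomial (Fin 2 ⊕ Fin 5) ℂ).range

/-- `m₁ ^ q c` lifts from `m₀ = 0` to the algebra generated by `linCov`, up to a factor `m₀`
when `q` is odd. -/
def Liftable (q : ℕ) (c : MvPolynomial (Fin 5) ℂ) : Prop :=
  ∃ b : MvPolynomial (Fin 2 ⊕ Fin 5) ℂ, X (Sum.inl 0) ^ (q % 2) * b ∈ linAlg ∧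
    ∀ (m : ℂ) (s : Fin 5 → ℂ), eval (Sum.elim ![0, m] s) b = m ^ q * eval s c

lemma Liftable.zero (q : ℕ) : Liftable q 0 := ⟨0, by simp, by simp⟩

lemma Liftable.add {q : ℕ} {c c' : MvPolynomial (Fin 5) ℂ} (h : Liftable q c)
    (h' : Liftable q c') : Liftable q (c + c') := by
  obtain ⟨b, hb, e⟩ := h
  obtain ⟨b', hb', e'⟩ := h'
  refine ⟨b + b', ?_, fun m s => ?_⟩
  · rw [mul_add]; exact add_mem hb hb'
  · rw [eval_add, eval_add, e, e', mul_add]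

lemma Liftable.C_mul {q : ℕ} {c : MvPolynomial (Fin 5) ℂ} (r : ℂ) (h : Liftable q c) :
    Liftable q (C r * c) := by
  obtain ⟨b, hb, e⟩ := h
  refine ⟨C r * b, ?_, fun m s => ?_⟩
  · rw [mul_left_comm]; exact mul_mem (Subalgebra.algebraMap_mem _ r) hb
  · rw [eval_mul, eval_mul, e, eval_C, eval_C, mul_left_comm]

lemma Liftable.mul {q q' : ℕ} {c c' : MvPolynomial (Fin 5) ℂ} (hq : q % 2 = 0 ∨ q' % 2 = 0)
    (h : Liftable q c) (h' : Liftable q' c') : Liftable (q + q') (c * c') := by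
  obtain ⟨b, hb, e⟩ := h
  obtain ⟨b', hb', e'⟩ := h'
  have hm : (q + q') % 2 = q % 2 + q' % 2 := by omega
  refine ⟨b * b', ?_, fun m s => ?_⟩
  · rw [hm, pow_add, mul_mul_mul_comm]; exact mul_mem hb hb'
  · rw [eval_mul, eval_mul, e, e', pow_add, mul_mul_mul_comm]

/-- All `m₁ ^ q c` with `q ≤ N` lift. -/
def LiftUpTo (N : ℕ) (c : MvPolynomial (Fin 5) ℂ) : Prop := ∀ q ≤ N, Liftable q c

lemma LiftUpTo.mono {N N' : ℕ} {c : MvPolynomial (Fin 5) ℂ} (hN : N' ≤ N) (h : LiftUpTo N c) :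
    LiftUpTo N' c := fun q hq => h q (hq.trans hN)

lemma LiftUpTo.mul_zero {N : ℕ} {c c' : MvPolynomial (Fin 5) ℂ} (h : LiftUpTo 0 c)
    (h' : LiftUpTo N c') : LiftUpTo N (c * c') := fun q hq => by
  simpa using (h 0 le_rfl).mul (Or.inl rfl) (h' q hq)

lemma LiftUpTo.mul_two {N : ℕ} {c c' : MvPolynomial (Fin 5) ℂ} (h : LiftUpTo 2 c)
    (h' : LiftUpTo N c') : LiftUpTo (N + 2) (c * c') := fun q hq => by
  rcases lt_or_ge q 2 with h2 | h2
  · simpa using (h q (by omega)).mul (Or.inr rfl) (h' 0 (Nat.zero_le _))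
  · have := (h 2 le_rfl).mul (Or.inl rfl) (h' (q - 2) (by omega))
    rwa [show 2 + (q - 2) = q by omega] at this

lemma LiftUpTo.pow_mul_zero {N : ℕ} {c c' : MvPolynomial (Fin 5) ℂ} (h : LiftUpTo 0 c)
    (h' : LiftUpTo N c') (k : ℕ) : LiftUpTo N (c ^ k * c') := by
  induction k with
  | zero => simpa using h'
  | succ k ih => rw [pow_succ', mul_assoc]; exact h.mul_zero ih

lemma LiftUpTo.pow_mul_two {N : ℕ} {c c' : MvPolynomial (Fin 5) ℂ} (h : LiftUpTo 2 c)
    (h' : LiftUpTo N c') (k : ℕ) : LiftUpTo (N + 2 * k) (c ^ k * c') := by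
  induction k with
  | zero => simpa using h'
  | succ k ih => rw [pow_succ', mul_assoc]; exact h.mul_two ih

lemma linCov_mem (j : Fin 18) : linCov j ∈ linAlg :=
  ⟨X j, by simp⟩

lemma liftable_linCov {q : ℕ} (hq : q % 2 = 0) (j : Fin 18) {c : MvPolynomial (Fin 5) ℂ}
    (h : ∀ (m : ℂ) (s : Fin 5 → ℂ), covBasic (linSq ![0, m]) s j = m ^ q * eval s c) :
    Liftable q c :=
  ⟨linCov j, by rw [hq, pow_zero, one_mul]; exact linCov_mem j,
    fun m s => by rw [eval_linCov, h]⟩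

/-- The cofactor of `m₀` in `m² - m₁² y²`. -/
def linAux {K : Type*} [CommRing K] (m : Fin 2 → K) : Fin 3 → K := ![m 0, 2 * m 1, 0]

lemma liftUpTo_seed_zero : LiftUpTo 2 (seedPoly 0) := by
  have h : LiftUpTo 2 (C (-24) * seedPoly 0) := by
    intro q hq
    interval_cases q
    · refine liftable_linCov rfl 4 fun m s => ?_
      simp [eval_seedPoly, seed, covBasic, basicInv, polarDisc, quarticOp, ySq]; ring
    · refine ⟨tripleDet ySq (linAux fun k => X (Sum.inl k))
        (quarticOp (fun k => X (Sum.inr k)) ySq), ?_, fun m s => ?_⟩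
      · convert linCov_mem 10 using 1
        simp [linCov, covBasic, basicInv, tripleDet, quarticOp, ySq, linAux, linSq]; ring
      · rw [map_tripleDet, map_ySq, map_quarticOp, map_ySq]
        simp [eval_seedPoly, seed, tripleDet, quarticOp, ySq, linAux, map_ofNat]; ring
    · refine liftable_linCov rfl 5 fun m s => ?_
      simp [eval_seedPoly, seed, covBasic, basicInv, polarDisc, quarticOp, ySq, linSq]; ring
  intro q hq
  have := (h q hq).C_mul (-1 / 24)
  rwa [← mul_assoc, ← C_mul, show (-1 / 24 : ℂ) * -24 = 1 by norm_num, C_1, one_mul] at this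

lemma liftUpTo_seed_one : LiftUpTo 2 (seedPoly 1) := by
  intro q hq
  interval_cases q
  · refine liftable_linCov rfl 7 fun m s => ?_
    simp [eval_seedPoly, seed, covBasic, basicInv]
  · refine ⟨tripleDet ySq (linAux fun k => X (Sum.inl k))
      (quarticOp (fun k => X (Sum.inr k)) (quarticOp (fun k => X (Sum.inr k)) ySq)), ?_,
      fun m s => ?_⟩
    · convert linCov_mem 12 using 1
      simp [linCov, covBasic, basicInv, tripleDet, quarticOp, ySq, linAux, linSq]; ring
    · rw [map_tripleDet, map_ySq, map_quarticOp, map_quarticOp, map_ySq]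
      simp [eval_seedPoly, seed, tripleDet, quarticOp, ySq, linAux, polarDisc, map_ofNat]; ring
  · refine liftable_linCov rfl 8 fun m s => ?_
    simp [eval_seedPoly, seed, covBasic, basicInv, polarDisc, quarticOp, ySq, linSq]; ring

lemma liftUpTo_seed_two : LiftUpTo 0 (seedPoly 2) := by
  intro q hq
  interval_cases q
  refine liftable_linCov rfl 2 fun m s => ?_
  simp [eval_seedPoly, seed, covBasic, basicInv]

lemma liftUpTo_seed_three : LiftUpTo 0 (seedPoly 3) := by
  intro q hq
  interval_cases q
  refine liftable_linCov rfl 3 fun m s => ?_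
  simp [eval_seedPoly, seed, covBasic, basicInv]

lemma liftUpTo_one : LiftUpTo 0 1 := by
  intro q hq
  interval_cases q
  exact ⟨1, by simp, by simp⟩

lemma liftUpTo_seedT : LiftUpTo 3 seedTPoly := by
  intro q hq
  interval_cases q
  · refine liftable_linCov rfl 14 fun m s => ?_
    simp [eval_seedTPoly, seedT, covBasic, basicInv]
  · have h : Liftable 1 (C (-4) * seedTPoly) := by
      set v' : Fin 3 → MvPolynomial (Fin 2 ⊕ Fin 5) ℂ := linAux fun k => X (Sum.inl k) with hv'
      set s' : Fin 5 → MvPolynomial (Fin 2 ⊕ Fin 5) ℂ := fun k => X (Sum.inr k) with hs'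
      refine ⟨linCov 4 * polarDisc (quarticOp s' ySq) (quarticOp s' v')
        - linCov 7 * polarDisc ySq (quarticOp s' v'), ?_, fun m s => ?_⟩
      · have : linCov 4 * linCov 8 - linCov 7 * linCov 5 ∈ linAlg :=
          sub_mem (mul_mem (linCov_mem _) (linCov_mem _)) (mul_mem (linCov_mem _) (linCov_mem _))
        convert this using 1
        simp [linCov, covBasic, basicInv, polarDisc, quarticOp, ySq, linAux, linSq, hv', hs']; ring
      · rw [eval_sub, eval_mul, eval_mul, eval_linCov, eval_linCov, map_polarDisc, map_polarDisc,
          map_quarticOp, map_quarticOp, map_ySq]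
        simp [eval_seedTPoly, seedT, tripleDet, quarticOp, ySq, linAux, polarDisc, map_ofNat,
          covBasic, basicInv, hv', hs']
        ring
    have := h.C_mul (-1 / 4)
    rwa [← mul_assoc, ← C_mul, show (-1 / 4 : ℂ) * -4 = 1 by norm_num, C_1, one_mul] at this
  · refine liftable_linCov rfl 15 fun m s => ?_
    simp [eval_seedTPoly, seedT, covBasic, basicInv, tripleDet, quarticOp, ySq, linSq]
  · have h : Liftable 3 (C (-8) * seedTPoly) := by
      set v' : Fin 3 → MvPolynomial (Fin 2 ⊕ Fin 5) ℂ := linAux fun k => X (Sum.inl k) with hv'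
      set s' : Fin 5 → MvPolynomial (Fin 2 ⊕ Fin 5) ℂ := fun k => X (Sum.inr k) with hs'
      refine ⟨2 * X (Sum.inl 1) ^ 2 * (linCov 4 * polarDisc (quarticOp s' ySq) (quarticOp s' v')
        - linCov 7 * polarDisc ySq (quarticOp s' v')) + X (Sum.inl 0) *
          (linCov 4 * polarDisc (quarticOp s' v') (quarticOp s' v')
            - linCov 7 * polarDisc v' (quarticOp s' v')), ?_, fun m s => ?_⟩
      · have : linCov 4 * linCov 9 - linCov 7 * linCov 6 ∈ linAlg :=
          sub_mem (mul_mem (linCov_mem _) (linCov_mem _)) (mul_mem (linCov_mem _) (linCov_mem _))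
        convert this using 1
        simp [linCov, covBasic, basicInv, polarDisc, quarticOp, ySq, linAux, linSq, hv', hs']; ring
      · simp only [eval_add, eval_mul, eval_sub, eval_linCov, map_polarDisc, map_quarticOp, map_ySq]
        simp [eval_seedTPoly, seedT, tripleDet, quarticOp, ySq, linAux, polarDisc, map_ofNat,
          covBasic, basicInv, hv', hs']
        ring
    have := h.C_mul (-1 / 8)
    rwa [← mul_assoc, ← C_mul, show (-1 / 8 : ℂ) * -8 = 1 by norm_num, C_1, one_mul] at this

lemma liftUpTo_monomial (a b c d e : ℕ) (he : e ≤ 1) :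
    LiftUpTo (2 * a + 2 * b + 3 * e)
      (seedPoly 0 ^ a * (seedPoly 1 ^ b * (seedPoly 2 ^ c *
        (seedPoly 3 ^ d * seedTPoly ^ e)))) := by
  have hT : LiftUpTo (3 * e) (seedTPoly ^ e) := by
    interval_cases e
    · simpa using liftUpTo_one
    · simpa using liftUpTo_seedT
  refine LiftUpTo.mono ?_ (liftUpTo_seed_zero.pow_mul_two (liftUpTo_seed_one.pow_mul_two
    (liftUpTo_seed_two.pow_mul_zero (liftUpTo_seed_three.pow_mul_zero hT d) c) b) a)
  omega

/-- Weights on the coordinates of a quartic form. -/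
def wtQuart (k : Fin 5) : Fin 3 → ℕ := ![0, 1, k]

/-- Weights of the seeds. -/
def wtSeed : Fin 4 → Fin 3 → ℕ := ![![0, 1, 0], ![0, 2, 2], ![0, 2, 4], ![0, 3, 6]]

lemma seedPoly_homogeneous (i : Fin 4) :
    IsWeightedHomogeneous wtQuart (seedPoly i) (wtSeed i) := by
  refine isWeightedHomogeneous_of_eval_scale fun j => ⟨0, fun x => ?_⟩
  rw [eval_seedPoly, eval_seedPoly]
  fin_cases i <;> fin_cases j <;>
    simp [seed, quarticI, quarticJ, polarDisc, tripleDet, quarticOp, ySq, wtQuart, wtSeed] <;> ring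

lemma seedTPoly_homogeneous : IsWeightedHomogeneous wtQuart seedTPoly ![0, 3, 3] := by
  refine isWeightedHomogeneous_of_eval_scale fun j => ⟨0, fun x => ?_⟩
  rw [eval_seedTPoly, eval_seedTPoly]
  fin_cases j <;> simp [seedT, tripleDet, quarticOp, ySq, wtQuart] <;> ring

lemma liftable_component {q r k e : ℕ} (he : e ≤ 1) (hq : q + k ≤ 2 * r)
    (p : MvPolynomial (Fin 4) ℂ) :
    Liftable q (weightedHomogeneousComponent wtQuart ![0, r, k]
      (seedTPoly ^ e * aeval seedPoly p)) := by
  induction p using MvPolynomial.induction_on' with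
  | add p p' h h' => rw [map_add, mul_add, map_add]; exact h.add h'
  | monomial β z =>
    have h1 := (seedTPoly_homogeneous.pow e).mul
      (isWeightedHomogeneous_aeval_monomial seedPoly_homogeneous β z)
    by_cases h : e • ![0, 3, 3] + Finsupp.weight wtSeed β = ![0, r, k]
    · rw [h] at h1
      rw [h1.weightedHomogeneousComponent_same]
      have hr := congrFun h 1
      have hk := congrFun h 2
      rw [Finsupp.weight_apply, Finsupp.sum_fintype _ _ (by simp)] at hr hk
      simp [Fin.sum_univ_four, wtSeed] at hr hk
      have := (liftUpTo_monomial (β 0) (β 1) (β 2) (β 3) e he q (by omega)).C_mul z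
      convert this using 1
      rw [aeval_monomial, Finsupp.prod_fintype _ _ (by simp), Fin.prod_univ_four, algebraMap_eq]
      ring
    · rw [h1.weightedHomogeneousComponent_ne _ (Ne.symm h)]
      exact Liftable.zero q

lemma covBasic_subst {K : Type*} [CommRing K] (b : K) (v : Fin 3 → K) (s : Fin 5 → K)
    (j : Fin 18) : covBasic (substQuad 1 b 0 1 v) (substQuart 1 b 0 1 s) j = covBasic v s j := by
  have := basicInv_subst (a := 1) (b := b) (c := 0) (d := 1) (by ring) ySq v s j.succ
  rwa [substQuad_ySq] at this

/-- The unipotent substitution on the coordinates of a linear form and a quartic form. -/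
def unipLin (b : ℂ) : Fin 2 ⊕ Fin 5 → MvPolynomial (Fin 2 ⊕ Fin 5) ℂ :=
  Sum.elim ![X (Sum.inl 0), X (Sum.inl 1) + C b * X (Sum.inl 0)]
    (substQuart 1 (C b) 0 1 fun k => X (Sum.inr k))

/-- The unipotent substitution on the coordinates of a quadratic form and a quartic form. -/
def unipQuad (b : ℂ) : Fin 3 ⊕ Fin 5 → MvPolynomial (Fin 3 ⊕ Fin 5) ℂ :=
  Sum.elim (substQuad 1 (C b) 0 1 fun k => X (Sum.inl k))
    (substQuart 1 (C b) 0 1 fun k => X (Sum.inr k))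

lemma eval_unipLin (b : ℂ) (m : Fin 2 → ℂ) (s : Fin 5 → ℂ)
    (P : MvPolynomial (Fin 2 ⊕ Fin 5) ℂ) :
    eval (Sum.elim m s) (aeval (unipLin b) P)
      = eval (Sum.elim ![m 0, m 1 + b * m 0] (substQuart 1 b 0 1 s)) P := by
  rw [eval_aeval]
  congr 2
  funext i
  rcases i with i | i <;> fin_cases i <;> simp [unipLin, substQuart, map_ofNat]

lemma eval_unipQuad (b : ℂ) (v : Fin 3 → ℂ) (s : Fin 5 → ℂ)
    (P : MvPolynomial (Fin 3 ⊕ Fin 5) ℂ) :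
    eval (Sum.elim v s) (aeval (unipQuad b) P)
      = eval (Sum.elim (substQuad 1 b 0 1 v) (substQuart 1 b 0 1 s)) P := by
  rw [eval_aeval]
  congr 2
  funext i
  rcases i with i | i <;> fin_cases i <;> simp [unipQuad, substQuad, substQuart, map_ofNat]

lemma funext_elim {α β : Type*} [Finite α] [Finite β] {P Q : MvPolynomial (α ⊕ β) ℂ}
    (h : ∀ (m : α → ℂ) (s : β → ℂ), eval (Sum.elim m s) P = eval (Sum.elim m s) Q) : P = Q :=
  MvPolynomial.funext fun x => by simpa using h (x ∘ Sum.inl) (x ∘ Sum.inr)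

lemma unipQuad_quadCov (b : ℂ) (j : Fin 18) : aeval (unipQuad b) (quadCov j) = quadCov j :=
  funext_elim fun v s => by rw [eval_unipQuad, eval_quadCov, eval_quadCov, covBasic_subst]

lemma linSq_unip (b : ℂ) (m : Fin 2 → ℂ) :
    linSq ![m 0, m 1 + b * m 0] = substQuad 1 b 0 1 (linSq m) := by
  funext k; fin_cases k <;> simp [linSq, substQuad] <;> ring

lemma unipLin_linCov (b : ℂ) (j : Fin 18) : aeval (unipLin b) (linCov j) = linCov j :=
  funext_elim fun v s => by rw [eval_unipLin, eval_linCov, eval_linCov, linSq_unip, covBasic_subst]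

lemma unipLin_linAlg (b : ℂ) {P : MvPolynomial (Fin 2 ⊕ Fin 5) ℂ} (h : P ∈ linAlg) :
    aeval (unipLin b) P = P := by
  obtain ⟨Y, rfl⟩ := h
  have : ((aeval (unipLin b)).comp (aeval linCov) : MvPolynomial (Fin 18) ℂ →ₐ[ℂ] _)
      = aeval linCov := by
    refine MvPolynomial.algHom_ext fun j => ?_
    rw [AlgHom.comp_apply, aeval_X, unipLin_linCov]
  exact DFunLike.congr_fun this Y

lemma component_mem_linAlg {P : MvPolynomial (Fin 2 ⊕ Fin 5) ℂ} (h : P ∈ linAlg)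
    (n : Fin 3 → ℕ) : weightedHomogeneousComponent wtLin n P ∈ linAlg := by
  obtain ⟨Y, rfl⟩ := h
  exact ⟨_, (weightedHomogeneousComponent_aeval linCov_homogeneous n Y).symm⟩

lemma X_sq_mem_linAlg : X (Sum.inl 0) ^ 2 ∈ linAlg := by
  have : X (Sum.inl 0) ^ 2 = C (-1 / 2) * linCov 0 :=
    funext_elim fun m s => by
      simp [eval_linCov, covBasic, basicInv, polarDisc, ySq, linSq]; ring
  rw [this]
  exact mul_mem (Subalgebra.algebraMap_mem _ _) (linCov_mem 0)

/-- The restriction to `m₀ = 0`. -/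
def restrLin : Fin 2 ⊕ Fin 5 → MvPolynomial (Fin 2 ⊕ Fin 5) ℂ :=
  Sum.elim ![0, X (Sum.inl 1)] fun k => X (Sum.inr k)

lemma restrLin_homogeneous (i : Fin 2 ⊕ Fin 5) :
    IsWeightedHomogeneous wtLin (restrLin i) (wtLin i) := by
  rcases i with i | i
  · fin_cases i
    · exact isWeightedHomogeneous_zero _ _ _
    · exact isWeightedHomogeneous_X _ _ _
  · exact isWeightedHomogeneous_X _ _ _

lemma eval_restrLin (m : Fin 2 → ℂ) (s : Fin 5 → ℂ) (P : MvPolynomial (Fin 2 ⊕ Fin 5) ℂ) :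
    eval (Sum.elim m s) (aeval restrLin P) = eval (Sum.elim ![0, m 1] s) P := by
  rw [eval_aeval]
  congr 2
  funext i
  rcases i with i | i
  · fin_cases i <;> simp [restrLin]
  · simp [restrLin]

lemma liftable_restriction {q r k : ℕ} (hk : k ≤ 2 * r) {P : MvPolynomial (Fin 2 ⊕ Fin 5) ℂ}
    (hP : IsWeightedHomogeneous wtLin P ![q, r, k]) (hU : ∀ b, aeval (unipLin b) P = P) :
    ∃ c : MvPolynomial (Fin 5) ℂ, Liftable q c ∧
      ∀ (m : ℂ) (s : Fin 5 → ℂ), eval (Sum.elim ![0, m] s) P = m ^ q * eval s c := by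
  set c : MvPolynomial (Fin 5) ℂ := aeval (Sum.elim ![0, 1] X) P with hc
  have hc1 : ∀ s : Fin 5 → ℂ, eval s c = eval (Sum.elim ![0, 1] s) P := by
    intro s
    rw [hc, eval_aeval]
    congr 2
    funext i
    rcases i with i | i
    · fin_cases i <;> simp
    · simp
  have hc2 : ∀ (m : ℂ) (s : Fin 5 → ℂ), eval (Sum.elim ![0, m] s) P = m ^ q * eval s c := by
    intro m s
    have := eval_scale_pi hP 0 m (Sum.elim ![0, 1] s)
    rw [hc1]
    rw [Matrix.cons_val_zero] at this
    rw [← this]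
    congr 2
    funext i
    rcases i with i | i
    · fin_cases i <;> simp [wtLin]
    · simp [wtLin]
  refine ⟨c, ?_, hc2⟩
  by_cases h0 : c = 0
  · rw [h0]; exact Liftable.zero q
  have hinv : IsSeedNormal c := by
    refine isSeedNormal_of_invariant fun b s => ?_
    have := eval_unipLin b ![0, 1] s P
    rw [hU] at this
    rw [hc1, hc1, this]
    simp
  have hs2 : ∀ s : Fin 5 → ℂ,
      4 ^ q * eval (fun i : Fin 5 => 4 ^ (i : ℕ) * s i) c = 4 ^ k * eval s c := by
    intro s
    have := eval_scale_pi hP 2 4 (Sum.elim ![0, 1] s)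
    rw [hc1 s, ← hc2]
    change _ = 4 ^ k * _ at this
    convert this using 3
    funext i
    rcases i with i | i
    · fin_cases i <;> simp [wtLin]
    · simp [wtLin]
  obtain ⟨β, hβ⟩ := MvPolynomial.ne_zero_iff.mp h0
  have hqk : q ≤ k := by
    have := weight_eq_of_eval_scale hs2 hβ
    omega
  have hch : IsWeightedHomogeneous wtQuart c ![0, r, k - q] := by
    refine isWeightedHomogeneous_of_eval_scale fun j => ?_
    fin_cases j
    · exact ⟨0, fun s => by simp [wtQuart]⟩
    · refine ⟨0, fun s => ?_⟩
      have := eval_scale_pi hP 1 4 (Sum.elim ![0, 1] s)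
      rw [hc1 s, hc1]
      simp only [pow_zero, one_mul, zero_add]
      change _ = 4 ^ r * _
      change _ = 4 ^ r * _ at this
      convert this using 3
      funext i
      rcases i with i | i
      · fin_cases i <;> simp [wtLin]
      · simp [wtLin, wtQuart]
    · refine ⟨q, fun s => ?_⟩
      simpa [wtQuart, Nat.add_sub_cancel' hqk] using hs2 s
  obtain ⟨p, p', hpp⟩ := hinv
  rw [← hch.weightedHomogeneousComponent_same, hpp, map_add]
  have h1 := liftable_component (q := q) (r := r) (k := k - q) (Nat.zero_le 1) (by omega) p
  have h2 := liftable_component (q := q) (r := r) (k := k - q) le_rfl (by omega) p'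
  rw [pow_zero, one_mul] at h1
  rw [pow_one] at h2
  exact h1.add h2

lemma unip_step {q r k : ℕ} (hk : k ≤ 2 * r) {P : MvPolynomial (Fin 2 ⊕ Fin 5) ℂ}
    (hP : IsWeightedHomogeneous wtLin P ![q, r, k]) (hU : ∀ b, aeval (unipLin b) P = P) :
    ∃ B Q : MvPolynomial (Fin 2 ⊕ Fin 5) ℂ, X (Sum.inl 0) ^ (q % 2) * B ∈ linAlg ∧
      P = B + X (Sum.inl 0) * Q ∧ (Q = 0 ∨ ∃ q', q = q' + 1 ∧
        IsWeightedHomogeneous wtLin Q ![q', r, k] ∧ ∀ b, aeval (unipLin b) Q = Q) := by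
  obtain ⟨c, ⟨B, hB, hBc⟩, hPc⟩ := liftable_restriction hk hP hU
  have hX : IsWeightedHomogeneous wtLin (X (Sum.inl 0) : MvPolynomial (Fin 2 ⊕ Fin 5) ℂ)
      ![1, 0, 0] := isWeightedHomogeneous_X _ _ _
  have hX0 : (X (Sum.inl 0) : MvPolynomial (Fin 2 ⊕ Fin 5) ℂ) ≠ 0 := X_ne_zero _
  set B' := weightedHomogeneousComponent wtLin ![q, r, k] B with hB'
  have hB'mem : X (Sum.inl 0) ^ (q % 2) * B' ∈ linAlg := by
    rw [hB', ← weightedHomogeneousComponent_mul_left (hX.pow (q % 2))]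
    exact component_mem_linAlg hB _
  have hB'h : IsWeightedHomogeneous wtLin B' ![q, r, k] :=
    weightedHomogeneousComponent_isWeightedHomogeneous _ _
  have hB'U : ∀ b, aeval (unipLin b) B' = B' := fun b =>
    aeval_cofactor (D := X (Sum.inl 0) ^ (q % 2)) (pow_ne_zero _ hX0) _ (by simp [unipLin])
      (unipLin_linAlg b hB'mem)
  have hres : aeval restrLin B = aeval restrLin P := funext_elim fun m s => by
    rw [eval_restrLin, eval_restrLin, hBc, hPc]
  have hres' : aeval restrLin B' = aeval restrLin P := by
    rw [hB', ← weightedHomogeneousComponent_aeval restrLin_homogeneous, hres,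
      weightedHomogeneousComponent_aeval restrLin_homogeneous,
      hP.weightedHomogeneousComponent_same]
  have hdvd : X (Sum.inl 0) ∣ P - B' := by
    refine X_dvd_of_eval (j := Sum.inl 1) (by simp) fun x hx _ => ?_
    have := congrArg (eval x) hres'
    rw [eval_aeval, eval_aeval] at this
    have hr : (fun j => eval x (restrLin j)) = x := by
      funext i
      rcases i with i | i
      · fin_cases i <;> simp [restrLin, hx]
      · simp [restrLin]
    rw [hr] at this
    rw [eval_sub, this, sub_self]
  obtain ⟨Q, hQ⟩ := hdvd
  refine ⟨B', Q, hB'mem, by rw [← hQ]; ring, ?_⟩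
  by_cases hQ0 : Q = 0
  · exact Or.inl hQ0
  refine Or.inr ?_
  obtain ⟨m, hm, hQm⟩ := exists_weight_of_mul hX hX0 hQ0 (hQ ▸ hP.sub hB'h)
  have e0 := congrFun hm 0
  have e1 := congrFun hm 1
  have e2 := congrFun hm 2
  simp at e0 e1 e2
  refine ⟨m 0, by omega, ?_, fun b => ?_⟩
  · convert hQm
    rw [e1, e2]
    funext j; fin_cases j <;> rfl
  · refine aeval_cofactor hX0 _ (by simp [unipLin]) ?_
    rw [← hQ, map_sub, hU, hB'U]

/-- Homogeneous invariants of the unipotent group on the space of a linear form and a quartic form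
lie in `linAlg`, up to a factor `m₀` in odd degree. -/
theorem mem_linAlg_of_unip_invariant {q r k : ℕ} (hk : k ≤ 2 * r)
    {P : MvPolynomial (Fin 2 ⊕ Fin 5) ℂ}
    (hP : IsWeightedHomogeneous wtLin P ![q, r, k]) (hU : ∀ b, aeval (unipLin b) P = P) :
    X (Sum.inl 0) ^ (q % 2) * P ∈ linAlg := by
  induction q generalizing P with
  | zero =>
    obtain ⟨B, Q, hB, rfl, rfl | ⟨q', hq', -⟩⟩ := unip_step hk hP hU
    · simpa using hB
    · omega
  | succ q ih =>
    obtain ⟨B, Q, hB, rfl, rfl | ⟨q', hq', hQ, hQU⟩⟩ := unip_step hk hP hU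
    · simpa using hB
    obtain rfl : q = q' := by omega
    have := ih hQ hQU
    rw [mul_add]
    refine add_mem hB ?_
    rcases Nat.mod_two_eq_zero_or_one q with h | h
    · have h' : (q + 1) % 2 = 1 := by omega
      rw [h, pow_zero, one_mul] at this
      rw [h', pow_one, ← mul_assoc, ← pow_two]
      exact mul_mem X_sq_mem_linAlg this
    · have h' : (q + 1) % 2 = 0 := by omega
      rw [h, pow_one] at this
      rwa [h', pow_zero, one_mul]

/-- The algebra generated by the polynomials `quadCov`. -/
def quadAlg : Subalgebra ℂ (MvPolynomial (Fin 3 ⊕ Fin 5) ℂ) :=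
  (aeval quadCov : MvPolynomial (Fin 18) ℂ →ₐ[ℂ] MvPolynomial (Fin 3 ⊕ Fin 5) ℂ).range

lemma eval_sqSubst (m : Fin 2 → ℂ) (s : Fin 5 → ℂ) (P : MvPolynomial (Fin 3 ⊕ Fin 5) ℂ) :
    eval (Sum.elim m s) (aeval sqSubst P) = eval (Sum.elim (linSq m) s) P := by
  rw [eval_aeval]
  congr 2
  funext i
  rcases i with i | i
  · fin_cases i <;> simp [sqSubst, linSq, map_ofNat]
  · simp [sqSubst]

lemma unipQuad_quadAlg (b : ℂ) {P : MvPolynomial (Fin 3 ⊕ Fin 5) ℂ} (h : P ∈ quadAlg) :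
    aeval (unipQuad b) P = P := by
  obtain ⟨Y, rfl⟩ := h
  have : ((aeval (unipQuad b)).comp (aeval quadCov) : MvPolynomial (Fin 18) ℂ →ₐ[ℂ] _)
      = aeval quadCov := by
    refine MvPolynomial.algHom_ext fun j => ?_
    rw [AlgHom.comp_apply, aeval_X, unipQuad_quadCov]
  exact DFunLike.congr_fun this Y

lemma exists_linSq {v : Fin 3 → ℂ} (h0 : v 0 ≠ 0) (h : v 1 ^ 2 = 4 * v 0 * v 2) :
    ∃ m, linSq m = v := by
  obtain ⟨z, hz⟩ := IsAlgClosed.exists_pow_nat_eq (v 0) (n := 2) (by norm_num)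
  have hz0 : z ≠ 0 := by
    rintro rfl
    exact h0 (by rw [← hz]; simp)
  refine ⟨![z, v 1 / (2 * z)], ?_⟩
  funext k
  fin_cases k
  · simpa [linSq] using hz
  · simp [linSq]; field_simp
  · simp [linSq]; field_simp; rw [h, ← hz]; ring

lemma quadCov_one : quadCov 1 = X (Sum.inl 1) ^ 2 - 4 * X (Sum.inl 0) * X (Sum.inl 2) := by
  simp [quadCov, covBasic, basicInv, polarDisc]; ring

lemma unip_quad_step {q r k : ℕ} (hk : k ≤ 2 * r) {P : MvPolynomial (Fin 3 ⊕ Fin 5) ℂ}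
    (hP : IsWeightedHomogeneous wtQuad P ![2 * q, r, k]) (hU : ∀ b, aeval (unipQuad b) P = P) :
    ∃ B Q : MvPolynomial (Fin 3 ⊕ Fin 5) ℂ, B ∈ quadAlg ∧
      P = B + quadCov 1 * Q ∧ (Q = 0 ∨ ∃ q' k', q = q' + 2 ∧ k = k' + 2 ∧
        IsWeightedHomogeneous wtQuad Q ![2 * q', r, k'] ∧ ∀ b, aeval (unipQuad b) Q = Q) := by
  have hS := isWeightedHomogeneous_aeval sqSubst_homogeneous hP
  have hSU : ∀ b, aeval (unipLin b) (aeval sqSubst P) = aeval sqSubst P := fun b =>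
    funext_elim fun m s => by
      rw [eval_unipLin, eval_sqSubst, eval_sqSubst, linSq_unip, ← eval_unipQuad, hU]
  have hmem := mem_linAlg_of_unip_invariant hk hS hSU
  rw [Nat.mul_mod_right, pow_zero, one_mul] at hmem
  obtain ⟨Y, hY⟩ := hmem
  replace hY : aeval linCov Y = aeval sqSubst P := hY
  set Y' := weightedHomogeneousComponent wtCov ![2 * q, r, k] Y with hY'
  have hY'e : aeval linCov Y' = aeval sqSubst P := by
    rw [hY', ← weightedHomogeneousComponent_aeval linCov_homogeneous, hY,
      hS.weightedHomogeneousComponent_same]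
  set B := aeval quadCov Y' with hB
  have hBh : IsWeightedHomogeneous wtQuad B ![2 * q, r, k] :=
    isWeightedHomogeneous_aeval quadCov_homogeneous
      (weightedHomogeneousComponent_isWeightedHomogeneous _ _)
  have hBmem : B ∈ quadAlg := ⟨Y', rfl⟩
  have hres : aeval sqSubst B = aeval sqSubst P := by
    rw [← hY'e, hB]
    have : ((aeval sqSubst).comp (aeval quadCov) : MvPolynomial (Fin 18) ℂ →ₐ[ℂ] _)
        = aeval linCov := by
      refine MvPolynomial.algHom_ext fun j => ?_
      rw [AlgHom.comp_apply, aeval_X, aeval_X, aeval_sqSubst_quadCov]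
    exact DFunLike.congr_fun this Y'
  have hdvd : quadCov 1 ∣ P - B := by
    rw [quadCov_one]
    refine polarDisc_dvd_of_eval (by simp) (by simp) fun x h0 h => ?_
    obtain ⟨m, hm⟩ := exists_linSq (v := fun k => x (Sum.inl k)) h0 h
    have := congrArg (eval (Sum.elim m fun k => x (Sum.inr k))) hres
    rw [eval_sqSubst, eval_sqSubst, hm] at this
    have hx : Sum.elim (fun k => x (Sum.inl k)) (fun k => x (Sum.inr k)) = x :=
      Sum.elim_comp_inl_inr x
    rw [hx] at this
    rw [eval_sub, this, sub_self]
  obtain ⟨Q, hQ⟩ := hdvd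
  refine ⟨B, Q, hBmem, by rw [← hQ]; ring, ?_⟩
  by_cases hQ0 : Q = 0
  · exact Or.inl hQ0
  refine Or.inr ?_
  have hD0 : quadCov 1 ≠ 0 := by
    intro h
    have := congrArg (eval (Sum.elim ![0, 1, 0] 0)) h
    simp [quadCov_one] at this
  obtain ⟨m, hm, hQm⟩ := exists_weight_of_mul (quadCov_homogeneous 1) hD0 hQ0 (hQ ▸ hP.sub hBh)
  have e0 := congrFun hm 0
  have e1 := congrFun hm 1
  have e2 := congrFun hm 2
  simp [wtCov, degV, degS, degU] at e0 e1 e2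
  refine ⟨q - 2, m 2, by omega, by omega, ?_, fun b => ?_⟩
  · convert hQm
    rw [e1]
    funext j; fin_cases j
    · simp; omega
    · rfl
    · rfl
  · refine aeval_cofactor hD0 _ (unipQuad_quadCov b 1) ?_
    rw [← hQ, map_sub, hU, unipQuad_quadAlg b hBmem]

/-- Homogeneous invariants of the unipotent group on the space of a quadratic form and a quartic
form, of sufficiently small weight, lie in `quadAlg`. -/
theorem mem_quadAlg_of_unip_invariant (q : ℕ) {r k : ℕ} (hk : k ≤ 2 * r)
    {P : MvPolynomial (Fin 3 ⊕ Fin 5) ℂ}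
    (hP : IsWeightedHomogeneous wtQuad P ![2 * q, r, k]) (hU : ∀ b, aeval (unipQuad b) P = P) :
    P ∈ quadAlg := by
  induction q using Nat.strong_induction_on generalizing k P with
  | _ q ih =>
    obtain ⟨B, Q, hB, rfl, rfl | ⟨q', k', hq', hk', hQ, hQU⟩⟩ := unip_quad_step hk hP hU
    · simpa using hB
    exact add_mem hB (mul_mem ⟨X 1, by simp⟩ (ih q' (by omega) (by omega) hQ hQU))

/-- The linear substitution on the coordinates of two quadratic forms and a quartic form induced by
a substitution of the two variables. -/
def sl2Subst (a b c d : ℂ) : Idx degs → MvPolynomial (Idx degs) ℂ :=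
  mkPt (substQuad (C a) (C b) (C c) (C d) fun k : Fin 3 => X ⟨0, k⟩)
    (substQuad (C a) (C b) (C c) (C d) fun k : Fin 3 => X ⟨1, k⟩)
    (substQuart (C a) (C b) (C c) (C d) fun k : Fin 5 => X ⟨2, k⟩)

lemma eval_sl2Subst (a b c d : ℂ) (u v : Fin 3 → ℂ) (s : Fin 5 → ℂ)
    (P : MvPolynomial (Idx degs) ℂ) :
    eval (mkPt u v s) (aeval (sl2Subst a b c d) P)
      = eval (mkPt (substQuad a b c d u) (substQuad a b c d v) (substQuart a b c d s)) P := by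
  rw [eval_aeval]
  congr 2
  rw [sl2Subst, comp_mkPt]
  congr 1 <;> funext k <;> fin_cases k <;> simp [substQuad, substQuart, mkPt, map_ofNat]

lemma funext_mkPt {P Q : MvPolynomial (Idx degs) ℂ}
    (h : ∀ u v s, eval (mkPt u v s) P = eval (mkPt u v s) Q) : P = Q :=
  MvPolynomial.funext fun x => by rw [← mkPt_eta x]; exact h _ _ _

lemma mem_invariantRing_iff_aeval (P : MvPolynomial (Idx degs) ℂ) :
    P ∈ invariantRing degs ↔
      ∀ a b c d : ℂ, a * d - b * c = 1 → aeval (sl2Subst a b c d) P = P := by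
  rw [mem_invariantRing_iff]
  refine ⟨fun h a b c d hd => funext_mkPt fun u v s => ?_, fun h a b c d hd u v s => ?_⟩
  · rw [eval_sl2Subst, h a b c d hd]
  · rw [← eval_sl2Subst, h a b c d hd]

/-- The tri-grading on the coordinate ring. -/
def wtTri (j : Idx degs) (i : Fin 3) : ℕ := if j.1 = i then 1 else 0

lemma wtTri_mul_mkPt (t : ℂ) (j : Fin 3) (u v : Fin 3 → ℂ) (s : Fin 5 → ℂ) :
    (fun i => t ^ wtTri i j * mkPt u v s i) = mkPt (fun k => (t ^ ![1, 0, 0] j) * u k)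
      (fun k => (t ^ ![0, 1, 0] j) * v k) (fun k => (t ^ ![0, 0, 1] j) * s k) := by
  funext ⟨i, k⟩
  fin_cases i <;> fin_cases j <;> rfl

lemma eval_triScale {p q r : ℕ} {f : MvPolynomial (Idx degs) ℂ}
    (hf : IsWeightedHomogeneous wtTri f ![p, q, r]) (l m n : ℂ) (u v : Fin 3 → ℂ)
    (s : Fin 5 → ℂ) :
    eval (mkPt (fun k => l * u k) (fun k => m * v k) (fun k => n * s k)) f
      = l ^ p * m ^ q * n ^ r * eval (mkPt u v s) f := by
  have h0 := eval_scale_pi hf 0 l (mkPt u v s)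
  have h1 := eval_scale_pi hf 1 m (mkPt (fun k => l * u k) v s)
  have h2 := eval_scale_pi hf 2 n (mkPt (fun k => l * u k) (fun k => m * v k) s)
  rw [wtTri_mul_mkPt] at h0 h1 h2
  simp at h0 h1 h2
  rw [h2, h1, h0]; ring

lemma isWeightedHomogeneous_triScale {p q r : ℕ} {f : MvPolynomial (Idx degs) ℂ}
    (h : ∀ (l m n : ℂ) (u v : Fin 3 → ℂ) (s : Fin 5 → ℂ),
      eval (mkPt (fun k => l * u k) (fun k => m * v k) (fun k => n * s k)) f
      = l ^ p * m ^ q * n ^ r * eval (mkPt u v s) f) :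
    IsWeightedHomogeneous wtTri f ![p, q, r] := by
  refine isWeightedHomogeneous_of_eval_scale fun j => ⟨0, fun x => ?_⟩
  rw [← mkPt_eta x, wtTri_mul_mkPt, h]
  fin_cases j <;> simp

lemma sl2Subst_homogeneous (a b c d : ℂ) (j : Idx degs) :
    IsWeightedHomogeneous wtTri (sl2Subst a b c d j) (wtTri j) := by
  obtain ⟨i, k⟩ := j
  fin_cases i
  · change IsWeightedHomogeneous wtTri _ (wtTri ⟨0, k⟩)
    have : wtTri ⟨0, k⟩ = ![1, 0, 0] := by funext i; fin_cases i <;> rfl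
    rw [this]
    refine isWeightedHomogeneous_triScale fun l m n u v s => ?_
    change Fin 3 at k
    fin_cases k <;> simp [sl2Subst, mkPt, substQuad, map_ofNat] <;> ring
  · change IsWeightedHomogeneous wtTri _ (wtTri ⟨1, k⟩)
    have : wtTri ⟨1, k⟩ = ![0, 1, 0] := by funext i; fin_cases i <;> rfl
    rw [this]
    refine isWeightedHomogeneous_triScale fun l m n u v s => ?_
    change Fin 3 at k
    fin_cases k <;> simp [sl2Subst, mkPt, substQuad, map_ofNat] <;> ring
  · change IsWeightedHomogeneous wtTri _ (wtTri ⟨2, k⟩)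
    have : wtTri ⟨2, k⟩ = ![0, 0, 1] := by funext i; fin_cases i <;> rfl
    rw [this]
    refine isWeightedHomogeneous_triScale fun l m n u v s => ?_
    change Fin 5 at k
    fin_cases k <;> simp [sl2Subst, mkPt, substQuart, map_ofNat] <;> ring

lemma component_mem_invariantRing {f : MvPolynomial (Idx degs) ℂ} (hf : f ∈ invariantRing degs)
    (n : Fin 3 → ℕ) : weightedHomogeneousComponent wtTri n f ∈ invariantRing degs := by
  rw [mem_invariantRing_iff_aeval] at hf ⊢
  intro a b c d h
  rw [← weightedHomogeneousComponent_aeval (sl2Subst_homogeneous a b c d), hf a b c d h]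

/-- Tri-degrees of the basic invariants. -/
def triDeg (i : Fin 19) : Fin 3 → ℕ := ![degU i, degV i, degS i]

lemma basicPoly_triHomogeneous (i : Fin 19) :
    IsWeightedHomogeneous wtTri (basicPoly i) (triDeg i) := by
  refine isWeightedHomogeneous_triScale fun l m n u v s => ?_
  have := basicInv_scale l m n 1 u v s i
  simp only [one_pow, mul_one] at this
  rw [eval_basicPoly, eval_basicPoly, this]

/-- The algebra generated by the basic invariants. -/
def basicAlg : Subalgebra ℂ (MvPolynomial (Idx degs) ℂ) :=
  (aeval basicPoly : MvPolynomial (Fin 19) ℂ →ₐ[ℂ] MvPolynomial (Idx degs) ℂ).range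

lemma basicPoly_mem_basicAlg (i : Fin 19) : basicPoly i ∈ basicAlg := ⟨X i, by simp⟩

lemma basicAlg_le : basicAlg ≤ invariantRing degs := by
  rw [basicAlg, ← Algebra.adjoin_range_eq_range_aeval]
  exact Algebra.adjoin_le (by rintro _ ⟨i, rfl⟩; exact basicPoly_mem i)

/-- Exchange of the two quadratic forms. -/
def swapForms : Idx degs → MvPolynomial (Idx degs) ℂ :=
  mkPt (fun k : Fin 3 => X ⟨1, k⟩) (fun k : Fin 3 => X ⟨0, k⟩) (fun k : Fin 5 => X ⟨2, k⟩)

lemma eval_swapForms (u v : Fin 3 → ℂ) (s : Fin 5 → ℂ) (P : MvPolynomial (Idx degs) ℂ) :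
    eval (mkPt u v s) (aeval swapForms P) = eval (mkPt v u s) P := by
  rw [eval_aeval, swapForms, comp_mkPt]
  simp [mkPt]

lemma basicInv_swap {K : Type*} [CommRing K] (u v : Fin 3 → K) (s : Fin 5 → K) (i : Fin 19) :
    basicInv v u s i = ![1, 1, 1, 1, 1, 1, 1, 1, 1, 1, 1, -1, -1, -1, -1, 1, 1, 1, 1] i
      * basicInv u v s (![2, 1, 0, 3, 4, 7, 6, 5, 10, 9, 8, 12, 11, 14, 13, 18, 17, 16, 15] i) := by
  fin_cases i <;> simp [basicInv, polarDisc, tripleDet, quarticOp] <;> ring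

lemma swap_basicPoly_mem (i : Fin 19) : aeval swapForms (basicPoly i) ∈ basicAlg := by
  have : aeval swapForms (basicPoly i)
      = C (![1, 1, 1, 1, 1, 1, 1, 1, 1, 1, 1, -1, -1, -1, -1, 1, 1, 1, 1] i) * basicPoly
        (![2, 1, 0, 3, 4, 7, 6, 5, 10, 9, 8, 12, 11, 14, 13, 18, 17, 16, 15] i) :=
    funext_mkPt fun u v s => by
      rw [eval_swapForms, eval_mul, eval_C, eval_basicPoly, eval_basicPoly, basicInv_swap]
  rw [this]
  exact mul_mem (Subalgebra.algebraMap_mem _ _) (basicPoly_mem_basicAlg _)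

lemma swap_mem_basicAlg {f : MvPolynomial (Idx degs) ℂ} (h : f ∈ basicAlg) :
    aeval swapForms f ∈ basicAlg := by
  have : basicAlg ≤ basicAlg.comap (aeval swapForms) := by
    conv_lhs => rw [basicAlg, ← Algebra.adjoin_range_eq_range_aeval]
    exact Algebra.adjoin_le (by rintro _ ⟨i, rfl⟩; exact swap_basicPoly_mem i)
  exact this h

lemma swap_swap (f : MvPolynomial (Idx degs) ℂ) : aeval swapForms (aeval swapForms f) = f :=
  funext_mkPt fun u v s => by rw [eval_swapForms, eval_swapForms]

lemma swap_mem_invariantRing {f : MvPolynomial (Idx degs) ℂ} (h : f ∈ invariantRing degs) :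
    aeval swapForms f ∈ invariantRing degs := by
  rw [mem_invariantRing_iff] at h ⊢
  intro a b c d hd u v s
  rw [eval_swapForms, eval_swapForms, h a b c d hd]

lemma swap_homogeneous {p q r : ℕ} {f : MvPolynomial (Idx degs) ℂ}
    (hf : IsWeightedHomogeneous wtTri f ![p, q, r]) :
    IsWeightedHomogeneous wtTri (aeval swapForms f) ![q, p, r] :=
  isWeightedHomogeneous_triScale fun l m n u v s => by
    rw [eval_swapForms, eval_swapForms, eval_triScale hf]; ring

/-- The restriction to `u = y²`. -/
def restrTri : Idx degs → MvPolynomial (Fin 3 ⊕ Fin 5) ℂ :=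
  mkPt ySq (fun k : Fin 3 => X (Sum.inl k)) (fun k : Fin 5 => X (Sum.inr k))

lemma eval_restrTri (v : Fin 3 → ℂ) (s : Fin 5 → ℂ) (P : MvPolynomial (Idx degs) ℂ) :
    eval (Sum.elim v s) (aeval restrTri P) = eval (mkPt ySq v s) P := by
  rw [eval_aeval, restrTri, comp_mkPt]
  congr 2
  simp only [eval_X, Sum.elim_inl, Sum.elim_inr]
  congr 1
  funext k; fin_cases k <;> simp [ySq]

lemma eval_torus {p q r : ℕ} {f : MvPolynomial (Idx degs) ℂ} (hf : f ∈ invariantRing degs)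
    (hh : IsWeightedHomogeneous wtTri f ![p, q, r]) (v : Fin 3 → ℂ) (s : Fin 5 → ℂ) :
    4 ^ p * eval (mkPt ySq (fun k : Fin 3 => 4 ^ (k : ℕ) * v k)
      (fun k : Fin 5 => 4 ^ (k : ℕ) * s k)) f = 4 ^ (q + 2 * r) * eval (mkPt ySq v s) f := by
  have h := (mem_invariantRing_iff f).mp hf (1 / 2) 0 0 2 (by norm_num) ySq v s
  have e1 : substQuad (1 / 2) 0 0 2 ySq = fun k => (4 : ℂ) * ySq k := by
    funext k; fin_cases k <;> simp [substQuad, ySq]; norm_num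
  have e2 : substQuad (1 / 2) 0 0 2 v = fun k : Fin 3 => (1 / 4 : ℂ) * (4 ^ (k : ℕ) * v k) := by
    funext k; fin_cases k <;> simp [substQuad, -mul_eq_mul_right_iff] <;> ring
  have e3 : substQuart (1 / 2) 0 0 2 s = fun k : Fin 5 => (1 / 16 : ℂ) * (4 ^ (k : ℕ) * s k) := by
    funext k; fin_cases k <;> simp [substQuart, -mul_eq_mul_right_iff] <;> ring
  rw [e1, e2, e3, eval_triScale hh] at h
  rw [← h, pow_add, pow_mul, one_div, one_div, inv_pow, inv_pow]
  norm_num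
  field_simp

lemma exists_move {u : Fin 3 → ℂ} (h0 : u 0 ≠ 0) (h : u 1 ^ 2 = 4 * u 0 * u 2) :
    ∃ a b c d : ℂ, a * d - b * c = 1 ∧ substQuad a b c d u = ySq := by
  obtain ⟨m, rfl⟩ := exists_linSq h0 h
  have hm : m 0 ≠ 0 := by
    intro hm; simp [linSq, hm] at h0
  refine ⟨m 1, 1 / m 0, -m 0, 0, by field_simp; ring, ?_⟩
  funext k
  fin_cases k
  · simp [substQuad, linSq, ySq]; ring
  · simp [substQuad, linSq, ySq]; field_simp; ring
  · simp [substQuad, linSq, ySq]; field_simp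

lemma basicPoly_zero :
    basicPoly 0 = X ⟨0, (1 : Fin 3)⟩ ^ 2 - 4 * X ⟨0, (0 : Fin 3)⟩ * X ⟨0, (2 : Fin 3)⟩ := by
  simp [basicPoly, basicInv, polarDisc]; ring

lemma basicPoly_zero_dvd {f : MvPolynomial (Idx degs) ℂ} (hf : f ∈ invariantRing degs)
    (h : aeval restrTri f = 0) : basicPoly 0 ∣ f := by
  rw [basicPoly_zero]
  refine polarDisc_dvd_of_eval (by decide) (by decide) fun x h0 hx => ?_
  obtain ⟨a, b, c, d, hd, hu⟩ := exists_move (u := fun k : Fin 3 => x ⟨0, k⟩) h0 hx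
  rw [← mkPt_eta x, ← (mem_invariantRing_iff f).mp hf a b c d hd, hu, ← eval_restrTri, h, map_zero]

lemma restrTri_basicPoly (j : Fin 18) : aeval restrTri (basicPoly j.succ) = quadCov j :=
  aeval_basicPoly _ _ _ _

lemma weight_triDeg {p q r : ℕ} (hle : p ≤ q + 2 * r) {β : Fin 18 →₀ ℕ}
    (h : Finsupp.weight wtCov β = ![2 * q, r, q + 2 * r - p]) :
    Finsupp.weight (fun j : Fin 18 => triDeg j.succ) β = ![p, q, r] := by
  have h0 := congrFun h 0
  have h1 := congrFun h 1
  have h2 := congrFun h 2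
  rw [weight_pi_apply, Finsupp.weight_apply, Finsupp.sum_fintype _ _ (by simp)] at h0 h1 h2
  have e0 : ∑ j, β j * degV j.succ = q := by
    have : 2 * ∑ j, β j * degV j.succ = 2 * q := by
      rw [Finset.mul_sum]
      refine Eq.trans (Finset.sum_congr rfl fun j _ => ?_) h0
      simp [wtCov]; ring
    omega
  have e1 : ∑ j, β j * degS j.succ = r := h1
  have e2 : ∑ j, β j * (degV j.succ + 2 * degS j.succ - degU j.succ) = q + 2 * r - p := h2
  have e3 : ∑ j, β j * (degV j.succ + 2 * degS j.succ - degU j.succ) + ∑ j, β j * degU j.succ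
      = ∑ j, β j * degV j.succ + 2 * ∑ j, β j * degS j.succ := by
    have : ∀ j : Fin 18, degV j.succ + 2 * degS j.succ - degU j.succ + degU j.succ
        = degV j.succ + 2 * degS j.succ := by decide
    rw [Finset.mul_sum, ← Finset.sum_add_distrib, ← Finset.sum_add_distrib]
    refine Finset.sum_congr rfl fun j _ => ?_
    rw [← mul_add, this]; ring
  have e4 : ∑ j, β j * degU j.succ = p := by omega
  funext i
  rw [weight_pi_apply, Finsupp.weight_apply, Finsupp.sum_fintype _ _ (by simp)]
  fin_cases i
  · exact e4
  · exact e0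
  · exact e1

lemma exists_restr_eq {p q r : ℕ} (hqp : q ≤ p) {f : MvPolynomial (Idx degs) ℂ}
    (hf : f ∈ invariantRing degs) (hh : IsWeightedHomogeneous wtTri f ![p, q, r]) :
    ∃ F ∈ basicAlg, IsWeightedHomogeneous wtTri F ![p, q, r] ∧
      aeval restrTri F = aeval restrTri f := by
  by_cases h0 : aeval restrTri f = 0
  · exact ⟨0, zero_mem _, isWeightedHomogeneous_zero _ _ _, by rw [h0, map_zero]⟩
  have hx : ∀ x : Fin 3 ⊕ Fin 5 → ℂ, x = Sum.elim (fun k => x (Sum.inl k)) fun k => x (Sum.inr k) :=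
    fun x => (Sum.elim_comp_inl_inr x).symm
  have key : ∀ x : Fin 3 ⊕ Fin 5 → ℂ,
      4 ^ p * eval (fun i => 4 ^ wtQuad i 2 * x i) (aeval restrTri f)
        = 4 ^ (q + 2 * r) * eval x (aeval restrTri f) := by
    intro x
    rw [hx fun i => _, hx x, eval_restrTri, eval_restrTri, ← eval_torus hf hh]
    rfl
  obtain ⟨β, hβ⟩ := MvPolynomial.ne_zero_iff.mp h0
  have hle := weight_eq_of_eval_scale key hβ
  have hle' : p ≤ q + 2 * r := by omega
  have hPh : IsWeightedHomogeneous wtQuad (aeval restrTri f) ![2 * q, r, q + 2 * r - p] := by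
    refine isWeightedHomogeneous_of_eval_scale fun j => ?_
    fin_cases j
    · refine ⟨0, fun x => ?_⟩
      rw [hx fun i => _, hx x, eval_restrTri, eval_restrTri]
      have := eval_triScale hh 1 16 1 ySq (fun k => x (Sum.inl k)) (fun k => x (Sum.inr k))
      simp [wtQuad] at this ⊢
      norm_num at this ⊢
      rw [this, pow_mul]; norm_num
    · refine ⟨0, fun x => ?_⟩
      rw [hx fun i => _, hx x, eval_restrTri, eval_restrTri]
      have := eval_triScale hh 1 1 4 ySq (fun k => x (Sum.inl k)) (fun k => x (Sum.inr k))
      simp [wtQuad] at this ⊢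
      rw [this]
    · refine ⟨p, fun x => ?_⟩
      simpa [Nat.add_sub_cancel' hle'] using key x
  have hPU : ∀ b, aeval (unipQuad b) (aeval restrTri f) = aeval restrTri f := fun b =>
    funext_elim fun v s => by
      rw [eval_unipQuad, eval_restrTri, eval_restrTri]
      conv_lhs => rw [← substQuad_ySq b]
      exact (mem_invariantRing_iff f).mp hf 1 b 0 1 (by ring) _ _ _
  obtain ⟨Y, hY⟩ := mem_quadAlg_of_unip_invariant q (by omega) hPh hPU
  replace hY : aeval quadCov Y = aeval restrTri f := hY
  set Y' := weightedHomogeneousComponent wtCov ![2 * q, r, q + 2 * r - p] Y with hY'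
  have hY'h : IsWeightedHomogeneous wtCov Y' ![2 * q, r, q + 2 * r - p] :=
    weightedHomogeneousComponent_isWeightedHomogeneous _ _
  have hY'e : aeval quadCov Y' = aeval restrTri f := by
    rw [hY', ← weightedHomogeneousComponent_aeval quadCov_homogeneous, hY,
      hPh.weightedHomogeneousComponent_same]
  have hY'h' : IsWeightedHomogeneous (fun j : Fin 18 => triDeg j.succ) Y' ![p, q, r] := by
    exact fun β hβ => weight_triDeg hle' (hY'h hβ)
  refine ⟨aeval (fun j : Fin 18 => basicPoly j.succ) Y', ?_, ?_, ?_⟩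
  · exact ⟨rename Fin.succ Y', aeval_rename Fin.succ basicPoly Y'⟩
  · exact isWeightedHomogeneous_aeval (w := wtTri) (d := fun j : Fin 18 => triDeg j.succ)
      (G := fun j : Fin 18 => basicPoly j.succ) (fun j => basicPoly_triHomogeneous j.succ) hY'h'
  · have : ((aeval restrTri).comp (aeval fun j : Fin 18 => basicPoly j.succ) :
        MvPolynomial (Fin 18) ℂ →ₐ[ℂ] _) = aeval quadCov := by
      refine MvPolynomial.algHom_ext fun j => ?_
      rw [AlgHom.comp_apply, aeval_X, aeval_X, restrTri_basicPoly]
    exact (DFunLike.congr_fun this Y').trans hY'e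

lemma invariant_step {p q r : ℕ} (hqp : q ≤ p) {f : MvPolynomial (Idx degs) ℂ}
    (hf : f ∈ invariantRing degs) (hh : IsWeightedHomogeneous wtTri f ![p, q, r]) :
    ∃ F ∈ basicAlg, ∃ Q, f = F + basicPoly 0 * Q ∧ (Q = 0 ∨ ∃ p', p = p' + 2 ∧
      IsWeightedHomogeneous wtTri Q ![p', q, r] ∧ Q ∈ invariantRing degs) := by
  obtain ⟨F, hF, hFh, hFr⟩ := exists_restr_eq hqp hf hh
  have hFR := basicAlg_le hF
  obtain ⟨Q, hQ⟩ := basicPoly_zero_dvd (sub_mem hf hFR) (by rw [map_sub, hFr, sub_self])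
  refine ⟨F, hF, Q, by rw [← hQ]; ring, ?_⟩
  by_cases hQ0 : Q = 0
  · exact Or.inl hQ0
  refine Or.inr ?_
  have hD0 : basicPoly 0 ≠ 0 := by
    intro h
    have := congrArg (eval (mkPt ![0, 1, 0] 0 0)) h
    rw [eval_basicPoly] at this
    simp [basicInv, polarDisc] at this
  obtain ⟨m, hm, hQm⟩ := exists_weight_of_mul (basicPoly_triHomogeneous 0) hD0 hQ0
    (hQ ▸ hh.sub hFh)
  have e0 := congrFun hm 0
  have e1 := congrFun hm 1
  have e2 := congrFun hm 2
  simp [triDeg, degV, degS, degU] at e0 e1 e2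
  refine ⟨m 0, by omega, ?_, ?_⟩
  · convert hQm
    rw [e1, e2]
    funext j; fin_cases j <;> rfl
  · rw [mem_invariantRing_iff_aeval] at hf hFR ⊢
    intro a b c d hd
    refine aeval_cofactor hD0 _ ((mem_invariantRing_iff_aeval _).mp (basicPoly_mem 0) a b c d hd) ?_
    rw [← hQ, map_sub, hf a b c d hd, hFR a b c d hd]

lemma mem_basicAlg_of_homogeneous (N : ℕ) {p q r : ℕ} (hN : p + q = N)
    {f : MvPolynomial (Idx degs) ℂ} (hf : f ∈ invariantRing degs)
    (hh : IsWeightedHomogeneous wtTri f ![p, q, r]) : f ∈ basicAlg := by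
  induction N using Nat.strong_induction_on generalizing p q f with
  | _ N ih =>
    have main : ∀ {p q : ℕ} {f : MvPolynomial (Idx degs) ℂ}, q ≤ p → p + q = N →
        f ∈ invariantRing degs → IsWeightedHomogeneous wtTri f ![p, q, r] → f ∈ basicAlg := by
      intro p q f hqp hN hf hh
      obtain ⟨F, hF, Q, rfl, rfl | ⟨p', hp', hQ, hQR⟩⟩ := invariant_step hqp hf hh
      · simpa using hF
      · exact add_mem hF (mul_mem (basicPoly_mem_basicAlg 0)
          (ih (p' + q) (by omega) rfl hQR hQ))
    rcases le_total q p with h | h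
    · exact main h hN hf hh
    · rw [← swap_swap f]
      exact swap_mem_basicAlg (main h (by omega) (swap_mem_invariantRing hf) (swap_homogeneous hh))

/-- The basic invariants generate the algebra of invariants. -/
theorem basicAlg_eq : basicAlg = invariantRing degs := by
  refine le_antisymm basicAlg_le fun f hf => ?_
  rw [← sum_weightedHomogeneousComponent wtTri f]
  refine finsum_induction (· ∈ basicAlg) (zero_mem _) (fun _ _ => add_mem) fun n => ?_
  refine mem_basicAlg_of_homogeneous _ (p := n 0) (q := n 1) (r := n 2) rfl
    (component_mem_invariantRing hf n) ?_
  have : ![n 0, n 1, n 2] = n := by funext j; fin_cases j <;> rfl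
  rw [this]
  exact weightedHomogeneousComponent_isWeightedHomogeneous _ _

lemma basicPoly_isHomogeneous (i : Fin 19) :
    (basicPoly i).IsHomogeneous (degU i + degV i + degS i) := by
  intro β hβ
  have := weight_eq_of_eval_scale (w := 1) (a := 0) (b := degU i + degV i + degS i)
    (P := basicPoly i) (fun x => ?_) hβ
  · simpa using this
  · have h := eval_triScale (basicPoly_triHomogeneous i) 4 4 4 (fun k : Fin 3 => x ⟨0, k⟩)
      (fun k : Fin 3 => x ⟨1, k⟩) (fun k : Fin 5 => x ⟨2, k⟩)
    rw [mkPt_eta, ← comp_mkPt, mkPt_eta] at h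
    simpa [pow_add] using h

lemma weight_triDeg_apply (β : Fin 19 →₀ ℕ) (k : Fin 3) :
    Finsupp.weight triDeg β k = ∑ j, β j * triDeg j k := by
  rw [Finsupp.weight_apply, Finsupp.sum_fintype _ _ (by simp)]
  simp

lemma weight_triDeg_expand (β : Fin 19 →₀ ℕ) :
    Finsupp.weight triDeg β 0 = 2 * β 0 + β 1 + 2 * β 5 + β 6 + 2 * β 8 + β 9 + 2 * β 11 + β 12
        + 2 * β 13 + β 14 + 3 * β 15 + 2 * β 16 + β 17 ∧
      Finsupp.weight triDeg β 1 = β 1 + 2 * β 2 + β 6 + 2 * β 7 + β 9 + 2 * β 10 + β 11 + 2 * β 12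
        + β 13 + 2 * β 14 + β 16 + 2 * β 17 + 3 * β 18 ∧
      Finsupp.weight triDeg β 2 = 2 * β 3 + 3 * β 4 + β 5 + β 6 + β 7 + 2 * β 8 + 2 * β 9
        + 2 * β 10 + β 11 + β 12 + 2 * β 13 + 2 * β 14 + 3 * β 15 + 3 * β 16 + 3 * β 17
        + 3 * β 18 := by
  simp only [weight_triDeg_apply]
  refine ⟨?_, ?_, ?_⟩
  · change ∑ i, β i * degU i = _
    rw [show degU = ![2, 1, 0, 0, 0, 2, 1, 0, 2, 1, 0, 2, 1, 2, 1, 3, 2, 1, 0] from rfl]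
    simp [Fin.sum_univ_succ]
    ring!
  · change ∑ i, β i * degV i = _
    rw [show degV = ![0, 1, 2, 0, 0, 0, 1, 2, 0, 1, 2, 1, 2, 1, 2, 0, 1, 2, 3] from rfl]
    simp [Fin.sum_univ_succ]
    ring!
  · change ∑ i, β i * degS i = _
    rw [show degS = ![0, 0, 0, 2, 3, 1, 1, 1, 2, 2, 2, 1, 1, 2, 2, 3, 3, 3, 3] from rfl]
    simp [Fin.sum_univ_succ]
    ring!

set_option maxHeartbeats 2000000 in
lemma one_le_of_weight_triDeg {i : Fin 19} {β : Fin 19 →₀ ℕ}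
    (h : Finsupp.weight triDeg β = triDeg i) (h3 : i ≠ 3 → β 3 = 0) : 1 ≤ β i := by
  have hz : ∀ j, (∃ k, triDeg i k < triDeg j k) → β j = 0 := by
    rintro j ⟨k, hk⟩
    have h1 : β j * triDeg j k ≤ Finsupp.weight triDeg β k := by
      rw [weight_triDeg_apply]
      exact Finset.single_le_sum (f := fun j => β j * triDeg j k) (fun _ _ => Nat.zero_le _)
        (Finset.mem_univ j)
    rw [h] at h1
    by_contra h0
    nlinarith [Nat.one_le_iff_ne_zero.mpr h0]
  obtain ⟨h0, h1, h2⟩ := weight_triDeg_expand β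
  rw [h] at h0 h1 h2
  simp only [Fin.exists_fin_succ] at hz
  by_contra hi
  have hi : β i = 0 := by omega
  fin_cases i <;>
    simp [triDeg, degU, degV, degS, Fin.forall_fin_succ] at h0 h1 h2 h3 hz hi <;> omega

lemma basicInv_test : basicInv (![0, 1, 1] : Fin 3 → ℂ) ![1, 0, 1] ![1, 0, 0, 1, 0]
    = ![1, -2, -4, 0, -216, -24, -18, -24, 144, 72, 36, 15, 18, 36, 90, 972, 1080, 1080, 756] := by
  funext i
  fin_cases i <;>
    simp [basicInv, polarDisc, tripleDet, quarticOp, quarticI, quarticJ] <;> norm_num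

lemma triDeg_ne_zero (i : Fin 19) : triDeg i ≠ 0 := by
  intro h
  have h0 := congrFun h 0
  have h1 := congrFun h 1
  have h2 := congrFun h 2
  revert h0 h1 h2
  fin_cases i <;> simp [triDeg, degU, degV, degS]

lemma eq_single_of_weight_triDeg {i : Fin 19} {β : Fin 19 →₀ ℕ}
    (h : Finsupp.weight triDeg β = triDeg i) (h3 : i ≠ 3 → β 3 = 0) :
    β = Finsupp.single i 1 := by
  have hle : Finsupp.single i 1 ≤ β := by
    rw [Finsupp.single_le_iff]
    exact one_le_of_weight_triDeg h h3
  obtain ⟨γ, rfl⟩ := exists_add_of_le hle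
  rw [map_add, Finsupp.weight_single, one_smul, add_eq_left] at h
  suffices γ = 0 by simp [this]
  ext j
  by_contra hj
  apply triDeg_ne_zero j
  funext k
  have := congrFun h k
  rw [weight_triDeg_apply, Pi.zero_apply, Finset.sum_eq_zero_iff] at this
  have := this j (Finset.mem_univ _)
  exact (mul_eq_zero.mp this).resolve_left hj

/-- A relation between the basic invariants has no linear terms. -/
lemma coeff_single_of_aeval_basicPoly {Y : MvPolynomial (Fin 19) ℂ}
    (hY : aeval basicPoly Y = 0) (i : Fin 19) : coeff (Finsupp.single i 1) Y = 0 := by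
  classical
  set Z := weightedHomogeneousComponent triDeg (triDeg i) Y with hZ
  have hZ0 : aeval basicPoly Z = 0 := by
    rw [hZ, ← weightedHomogeneousComponent_aeval basicPoly_triHomogeneous, hY, map_zero]
  have hc : coeff (Finsupp.single i 1) Z = coeff (Finsupp.single i 1) Y := by
    rw [hZ, coeff_weightedHomogeneousComponent, if_pos (by simp [Finsupp.weight_single])]
  have hw : ∀ β ∈ Z.support, Finsupp.weight triDeg β = triDeg i := fun β hβ =>
    weightedHomogeneousComponent_isWeightedHomogeneous _ _ (mem_support_iff.mp hβ)
  rw [← hc]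
  by_contra hne
  set x : Fin 19 → ℂ := basicInv ![0, 1, 1] ![1, 0, 1]
    ![if i = 3 then 0 else 1, 0, if i = 3 then 1 else 0, if i = 3 then 0 else 1, 0] with hx
  have hx3 : i ≠ 3 → x 3 = 0 := by
    intro h
    simp only [hx, h, if_false, basicInv_test]; simp
  have hxi : x i ≠ 0 := by
    by_cases h : i = 3
    · subst h
      simp [hx, basicInv, quarticI]
    · simp only [hx, h, if_false, basicInv_test]
      fin_cases i <;> simp at h ⊢
  have he : eval x Z = 0 := by
    have := congrArg (eval (mkPt ![0, 1, 1] ![1, 0, 1]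
      ![if i = 3 then 0 else 1, 0, if i = 3 then 1 else 0, if i = 3 then 0 else 1, 0])) hZ0
    rw [eval_aeval, map_zero] at this
    simpa only [eval_basicPoly] using this
  rw [eval_eq', Finset.sum_eq_single (Finsupp.single i 1)] at he
  · rw [Finset.prod_eq_single i] at he
    · simp [hne, hxi] at he
    · intro j _ hj
      simp [Finsupp.single_eq_of_ne hj]
    · simp
  · intro β hβ hb
    by_cases h3 : i ≠ 3 → β 3 = 0
    · exact absurd (eq_single_of_weight_triDeg (hw β hβ) h3) hb
    · push Not at h3
      rw [Finset.prod_eq_zero (Finset.mem_univ 3), mul_zero]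
      rw [hx3 h3.1, zero_pow h3.2]
  · intro h
    exact absurd (notMem_support_iff.mp h) hne

lemma basicPoly_injective : Function.Injective basicPoly := by
  intro i j hij
  by_contra hne
  have := coeff_single_of_aeval_basicPoly (Y := X i - X j) (by simp [hij]) i
  rw [coeff_sub, coeff_X, coeff_X, if_pos rfl, if_neg] at this
  · simp at this
  · intro h
    exact hne (Finsupp.single_left_injective one_ne_zero h).symm

/-- The vector of linear coefficients of a polynomial. -/
def linCoeff : MvPolynomial (Fin 19) ℂ →ₗ[ℂ] (Fin 19 → ℂ) :=
  LinearMap.pi fun j => lcoeff ℂ (Finsupp.single j 1)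

lemma linCoeff_apply (W : MvPolynomial (Fin 19) ℂ) (j : Fin 19) :
    linCoeff W j = coeff (Finsupp.single j 1) W := rfl

lemma linCoeff_mul (V W : MvPolynomial (Fin 19) ℂ) :
    linCoeff (V * W) = coeff 0 V • linCoeff W + coeff 0 W • linCoeff V := by
  have key : ∀ (V : MvPolynomial (Fin 19) ℂ) j,
      linCoeff V j = constantCoeff (pderiv j V) := by
    intro V j
    rw [constantCoeff_eq, coeff_pderiv, linCoeff_apply]; simp
  funext j
  simp only [Pi.add_apply, Pi.smul_apply, key, Derivation.leibniz, smul_eq_mul, map_add, map_mul,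
    constantCoeff_eq]

lemma linCoeff_aeval_mem {σ : Type*} (Y : σ → MvPolynomial (Fin 19) ℂ) (Z : MvPolynomial σ ℂ) :
    linCoeff (aeval Y Z) ∈ Submodule.span ℂ (Set.range fun s => linCoeff (Y s)) := by
  induction Z using MvPolynomial.induction_on with
  | C a =>
    have : linCoeff (aeval Y (C a)) = 0 := by
      funext j
      rw [aeval_C, algebraMap_eq, linCoeff_apply, coeff_C, if_neg]
      · rfl
      · intro h
        simpa using DFunLike.congr_fun h j
    rw [this]; exact zero_mem _
  | add p q hp hq => rw [map_add, map_add]; exact add_mem hp hq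
  | mul_X p i hp =>
    rw [map_mul, linCoeff_mul, aeval_X]
    exact add_mem (Submodule.smul_mem _ _ (Submodule.subset_span ⟨i, rfl⟩))
      (Submodule.smul_mem _ _ hp)

lemma card_generators_ge {S : Finset (MvPolynomial (Idx degs) ℂ)}
    (hS : Algebra.adjoin ℂ (S : Set (MvPolynomial (Idx degs) ℂ)) = invariantRing degs) :
    19 ≤ S.card := by
  have h1 : ∀ s : S, ∃ Y : MvPolynomial (Fin 19) ℂ,
      aeval basicPoly Y = (s : MvPolynomial (Idx degs) ℂ) := by
    intro s
    have : (s : MvPolynomial (Idx degs) ℂ) ∈ basicAlg := by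
      rw [basicAlg_eq, ← hS]; exact Algebra.subset_adjoin s.2
    exact this
  choose Y hY using h1
  have h2 : ∀ i, ∃ Z : MvPolynomial S ℂ, aeval (fun s : S => (s : MvPolynomial (Idx degs) ℂ)) Z
      = basicPoly i := by
    intro i
    have : basicPoly i ∈ Algebra.adjoin ℂ
        (Set.range fun s : S => (s : MvPolynomial (Idx degs) ℂ)) := by
      rw [Subtype.range_coe_subtype]
      have := basicPoly_mem i
      rw [← hS] at this
      exact this
    rw [Algebra.adjoin_range_eq_range_aeval] at this
    exact this
  choose Z hZ using h2
  have h3 : ∀ i, linCoeff (aeval Y (Z i)) = Pi.single i 1 := by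
    intro i
    funext j
    have h0 : aeval basicPoly (aeval Y (Z i) - X i) = 0 := by
      rw [map_sub, aeval_X, sub_eq_zero, ← hZ i]
      have : (fun s : S => (s : MvPolynomial (Idx degs) ℂ)) = fun s : S => aeval basicPoly (Y s) :=
        funext fun s => (hY s).symm
      rw [this]
      exact comp_aeval_apply Y (aeval basicPoly) (Z i)
    have := coeff_single_of_aeval_basicPoly h0 j
    rw [coeff_sub, sub_eq_zero] at this
    rw [linCoeff_apply, this, coeff_X, Pi.single_apply]
    congr 1
    rw [eq_iff_iff]
    exact ⟨fun h => (Finsupp.single_left_injective one_ne_zero h).symm, fun h => by rw [h]⟩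
  have h4 : Submodule.span ℂ (Set.range fun s => linCoeff (Y s)) = ⊤ := by
    rw [eq_top_iff, ← (Pi.basisFun ℂ (Fin 19)).span_eq, Submodule.span_le]
    rintro _ ⟨i, rfl⟩
    rw [Pi.basisFun_apply, ← h3 i]
    exact linCoeff_aeval_mem _ _
  have h5 := finrank_range_le_card (R := ℂ) (fun s => linCoeff (Y s))
  rw [Set.finrank, h4, finrank_top] at h5
  simpa using h5

lemma hasMinimalGens_degs : HasMinimalGens degs
    ![2, 2, 2, 2, 3, 3, 3, 3, 4, 4, 4, 4, 4, 5, 5, 6, 6, 6, 6] := by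
  have hadj : Algebra.adjoin ℂ (Set.range basicPoly) = invariantRing degs := by
    rw [Algebra.adjoin_range_eq_range_aeval]; exact basicAlg_eq
  refine ⟨⟨⟨Finset.univ.image basicPoly, ?_, ?_⟩, ?_⟩, basicPoly, basicPoly_injective, ?_, hadj⟩
  · rw [Finset.card_image_of_injective _ basicPoly_injective]; simp
  · rw [Finset.coe_image, Finset.coe_univ, Set.image_univ, hadj]
  · rintro k ⟨S, rfl, hS⟩
    exact card_generators_ge hS
  · intro j
    have := basicPoly_isHomogeneous j
    revert this
    fin_cases j <;> exact id

/-- Where a system of parameters vanishes, all invariants of positive degree vanish. -/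
lemma eval_eq_zero_of_isIntegral {σ : Type*} {k : ℕ} {P : Fin k → MvPolynomial σ ℂ}
    {d : Fin k → ℕ} (hP : ∀ j, (P j).IsHomogeneous (d j)) {x : σ → ℂ}
    (hx : ∀ j, eval x (P j) = 0) {f : MvPolynomial σ ℂ} {n : ℕ} (hn : 0 < n)
    (hf : f.IsHomogeneous n) (hi : IsIntegral (Algebra.adjoin ℂ (Set.range P)) f) :
    eval x f = 0 := by
  have hscale : ∀ {m : ℕ} {q : MvPolynomial σ ℂ}, q.IsHomogeneous m → ∀ t : ℂ,
      eval (fun i => t * x i) q = t ^ m * eval x q := by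
    intro m q hq t
    have := eval_scale hq t x
    simpa using this
  have hA : ∀ a ∈ Algebra.adjoin ℂ (Set.range P), ∀ t : ℂ,
      eval (fun i => t * x i) a = eval 0 a := by
    intro a ha t
    induction ha using Algebra.adjoin_induction with
    | mem q hq =>
      obtain ⟨j, rfl⟩ := hq
      have h0 : eval (fun i => 0 * x i) (P j) = 0 := by
        rw [hscale (hP j), hx j, mul_zero]
      have h00 : (fun i => 0 * x i) = 0 := by funext i; simp
      rw [h00] at h0
      rw [hscale (hP j), hx j, mul_zero, h0]
    | algebraMap r => simp [algebraMap_eq]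
    | add p q _ _ hp hq => rw [map_add, map_add, hp, hq]
    | mul p q _ _ hp hq => rw [map_mul, map_mul, hp, hq]
  obtain ⟨p, hp, hpf⟩ := hi
  let ψ : Algebra.adjoin ℂ (Set.range P) →+* ℂ :=
    (eval (0 : σ → ℂ)).comp (algebraMap _ (MvPolynomial σ ℂ))
  have hroot : ∀ t : ℂ, (p.map ψ).eval (t ^ n * eval x f) = 0 := by
    intro t
    have h := congrArg (eval (fun i => t * x i)) hpf
    rw [Polynomial.hom_eval₂, map_zero, hscale hf] at h
    rw [Polynomial.eval_map, ← h]
    congr 1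
    ext a
    exact (hA a a.2 t).symm
  by_contra hc
  have : p.map ψ = 0 := by
    refine Polynomial.funext fun z => ?_
    obtain ⟨t, ht⟩ := IsAlgClosed.exists_pow_nat_eq (z / eval x f) hn
    have := hroot t
    rw [ht, div_mul_cancel₀ _ hc] at this
    rw [this, Polynomial.eval_zero]
  exact (hp.map ψ).ne_zero this

/-- The degrees of the basic invariants. -/
def totDeg : Fin 19 → ℕ := ![2, 2, 2, 2, 3, 3, 3, 3, 4, 4, 4, 4, 4, 5, 5, 6, 6, 6, 6]

lemma basicPoly_isHomogeneous_totDeg (i : Fin 19) : (basicPoly i).IsHomogeneous (totDeg i) := by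
  have := basicPoly_isHomogeneous i
  revert this
  fin_cases i <;> exact id

lemma exists_aeval_basicPoly {f : MvPolynomial (Idx degs) ℂ} (hf : f ∈ invariantRing degs) {n : ℕ}
    (hn : f.IsHomogeneous n) :
    ∃ Y : MvPolynomial (Fin 19) ℂ, IsWeightedHomogeneous totDeg Y n ∧ aeval basicPoly Y = f := by
  rw [← basicAlg_eq] at hf
  obtain ⟨Y, hY⟩ := hf
  refine ⟨weightedHomogeneousComponent totDeg n Y,
    weightedHomogeneousComponent_isWeightedHomogeneous _ _, ?_⟩
  rw [← weightedHomogeneousComponent_aeval (w := (1 : Idx degs → ℕ)) (d := totDeg)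
    basicPoly_isHomogeneous_totDeg]
  have hY : aeval basicPoly Y = f := hY
  rw [hY]
  exact IsWeightedHomogeneous.weightedHomogeneousComponent_same hn

lemma eval_eq_zero_of_support {σ : Type*} {x : σ → ℂ} {Y : MvPolynomial σ ℂ}
    (h : ∀ β, coeff β Y ≠ 0 → ∃ j, β j ≠ 0 ∧ x j = 0) : eval x Y = 0 := by
  rw [eval_eq]
  refine Finset.sum_eq_zero fun β hβ => ?_
  obtain ⟨j, hj, hx⟩ := h β (mem_support_iff.mp hβ)
  rw [Finset.prod_eq_zero (Finsupp.mem_support_iff.mpr hj), mul_zero]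
  rw [hx, zero_pow hj]

lemma weight_totDeg (β : Fin 19 →₀ ℕ) : Finsupp.weight totDeg β =
    2 * (β 0 + β 1 + β 2 + β 3) + 3 * (β 4 + β 5 + β 6 + β 7)
      + 4 * (β 8 + β 9 + β 10 + β 11 + β 12) + 5 * (β 13 + β 14)
      + 6 * (β 15 + β 16 + β 17 + β 18) := by
  rw [Finsupp.weight_apply, Finsupp.sum_fintype _ _ (by simp)]
  change ∑ i, β i * totDeg i = _
  have h : ∀ i, totDeg i = triDeg i 0 + triDeg i 1 + triDeg i 2 := by
    intro i; fin_cases i <;> rfl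
  obtain ⟨h0, h1, h2⟩ := weight_triDeg_expand β
  rw [weight_triDeg_apply] at h0 h1 h2
  simp only [h, mul_add, Finset.sum_add_distrib, h0, h1, h2]
  ring

/-- The point with quadratic parts `a y²`, `b y²` and quartic part `x³ y`. -/
def nilPt (a b : ℂ) : Idx degs → ℂ := mkPt ![0, 0, a] ![0, 0, b] ![0, 1, 0, 0, 0]

lemma basicInv_nilPt (a b : ℂ) :
    basicInv ![0, 0, a] ![0, 0, b] ![0, 1, 0, 0, 0]
      = ![0, 0, 0, 0, 0, 0, 0, 0, 36 * a ^ 2, 36 * a * b, 36 * b ^ 2, 0, 0, 0, 0,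
        108 * a ^ 3, 108 * a ^ 2 * b, 108 * a * b ^ 2, 108 * b ^ 3] := by
  funext i
  fin_cases i <;> simp [basicInv, polarDisc, tripleDet, quarticOp, quarticI, quarticJ] <;> ring

lemma eval_nilPt_aeval (a b : ℂ) (Y : MvPolynomial (Fin 19) ℂ) :
    eval (nilPt a b) (aeval basicPoly Y)
      = eval (basicInv ![0, 0, a] ![0, 0, b] ![0, 1, 0, 0, 0]) Y := by
  rw [eval_aeval]
  simp only [nilPt, eval_basicPoly]

lemma eval_nilPt_of_lt {f : MvPolynomial (Idx degs) ℂ} (hf : f ∈ invariantRing degs) {n : ℕ}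
    (hn : f.IsHomogeneous n) (h0 : 0 < n) (h4 : n < 4) (a b : ℂ) : eval (nilPt a b) f = 0 := by
  obtain ⟨Y, hY, rfl⟩ := exists_aeval_basicPoly hf hn
  rw [eval_nilPt_aeval]
  refine eval_eq_zero_of_support fun β hβ => ?_
  have := hY hβ
  rw [weight_totDeg] at this
  have h : ∃ j : Fin 19, j < 8 ∧ β j ≠ 0 := by
    by_contra! h
    simp only [h 0 (by decide), h 1 (by decide), h 2 (by decide), h 3 (by decide),
      h 4 (by decide), h 5 (by decide), h 6 (by decide), h 7 (by decide)] at this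
    rcases Nat.eq_zero_or_pos (β 8 + β 9 + β 10 + β 11 + β 12) with h' | h'
    · rcases Nat.eq_zero_or_pos (β 13 + β 14) with h'' | h'' <;> omega
    · omega
  obtain ⟨j, hj, hβj⟩ := h
  refine ⟨j, hβj, ?_⟩
  rw [basicInv_nilPt]
  revert hj
  clear hβj
  fin_cases j <;> simp

lemma exists_eval_nilPt {f : MvPolynomial (Idx degs) ℂ} (hf : f ∈ invariantRing degs)
    (hn : f.IsHomogeneous 4) :
    ∃ A B D : ℂ, ∀ a b, eval (nilPt a b) f = A * a ^ 2 + B * a * b + D * b ^ 2 := by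
  obtain ⟨Y, hY, rfl⟩ := exists_aeval_basicPoly hf hn
  refine ⟨36 * coeff (Finsupp.single 8 1) Y, 36 * coeff (Finsupp.single 9 1) Y,
    36 * coeff (Finsupp.single 10 1) Y, fun a b => ?_⟩
  rw [eval_nilPt_aeval]
  set x := basicInv ![0, 0, a] ![0, 0, b] ![0, 1, 0, 0, 0] with hx
  set W := Y - (C (coeff (Finsupp.single 8 1) Y) * X 8 + C (coeff (Finsupp.single 9 1) Y) * X 9
    + C (coeff (Finsupp.single 10 1) Y) * X 10) with hW
  have hWw : IsWeightedHomogeneous totDeg W 4 := by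
    refine IsWeightedHomogeneous.sub hY ((IsWeightedHomogeneous.add ?_ ?_).add ?_)
    all_goals exact IsWeightedHomogeneous.C_mul (isWeightedHomogeneous_X ℂ totDeg _) _
  have hc : ∀ j : Fin 19, j = 8 ∨ j = 9 ∨ j = 10 → coeff (Finsupp.single j 1) W = 0 := by
    have hne : ∀ i j : Fin 19, i ≠ j → (Finsupp.single i 1 : Fin 19 →₀ ℕ) ≠ Finsupp.single j 1 :=
      fun i j h h' => h (Finsupp.single_left_injective one_ne_zero h')
    rintro j (rfl | rfl | rfl) <;>
      simp [hW, coeff_C_mul, coeff_X, hne]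
  have h0 : eval x W = 0 := by
    refine eval_eq_zero_of_support fun β hβ => ?_
    have hw := hWw hβ
    rw [weight_totDeg] at hw
    by_contra! h
    have hz : ∀ j : Fin 19, (j < 8 ∨ j = 11 ∨ j = 12) → β j = 0 := by
      intro j hj
      by_contra hb
      refine h j hb ?_
      rw [hx, basicInv_nilPt]
      clear hb
      revert hj
      fin_cases j <;> simp
    simp only [hz 0 (by decide), hz 1 (by decide), hz 2 (by decide), hz 3 (by decide),
      hz 4 (by decide), hz 5 (by decide), hz 6 (by decide), hz 7 (by decide), hz 11 (by decide),
      hz 12 (by decide)] at hw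
    have hj : ∃ j : Fin 19, (j = 8 ∨ j = 9 ∨ j = 10) ∧ β j ≠ 0 := by
      by_contra! h'
      simp only [h' 8 (by decide), h' 9 (by decide), h' 10 (by decide)] at hw
      omega
    obtain ⟨j, hj, hb⟩ := hj
    obtain ⟨γ, rfl⟩ := exists_add_of_le
      (Finsupp.single_le_iff.mpr (Nat.one_le_iff_ne_zero.mpr hb))
    have hw' := hWw hβ
    rw [map_add, Finsupp.weight_single, one_smul,
      show totDeg j = 4 by rcases hj with rfl | rfl | rfl <;> rfl, weight_totDeg] at hw'
    have : γ = 0 := by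
      ext i
      fin_cases i <;> simp <;> omega
    rw [this, add_zero, hc j hj] at hβ
    exact hβ rfl
  rw [hW, map_sub, sub_eq_zero] at h0
  rw [h0, hx, basicInv_nilPt]
  simp
  ring

lemma exists_quadratic_zero (A B D : ℂ) :
    ∃ a b : ℂ, (a ≠ 0 ∨ b ≠ 0) ∧ A * a ^ 2 + B * a * b + D * b ^ 2 = 0 := by
  by_cases hA : A = 0
  · exact ⟨1, 0, Or.inl one_ne_zero, by simp [hA]⟩
  · obtain ⟨r, hr⟩ := IsAlgClosed.exists_pow_nat_eq (B ^ 2 - 4 * A * D) two_pos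
    refine ⟨-B + r, 2 * A, Or.inr (by simpa using hA), ?_⟩
    linear_combination A * hr

lemma not_isHSOP_degs : ¬ ∃ P : Fin 8 → MvPolynomial (Idx degs) ℂ,
    IsHSOP degs P ![2, 2, 2, 2, 3, 3, 3, 4] := by
  rintro ⟨P, hP, hd, hh, -, hi⟩
  obtain ⟨A, B, D, hf⟩ := exists_eval_nilPt (hP 7) (hh 7)
  obtain ⟨a, b, hab, h0⟩ := exists_quadratic_zero A B D
  have hx : ∀ j, eval (nilPt a b) (P j) = 0 := by
    intro j
    by_cases hj : j = 7
    · rw [hj, hf, h0]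
    · refine eval_nilPt_of_lt (hP j) (hh j) (hd j) ?_ a b
      clear hh hd hi hP hf
      fin_cases j <;> simp at hj ⊢
  have key := fun i => eval_eq_zero_of_isIntegral hh hx (n := totDeg i)
    (by fin_cases i <;> simp [totDeg]) (basicPoly_isHomogeneous_totDeg i) (hi _ (basicPoly_mem i))
  have h8 := key 8
  have h10 := key 10
  rw [nilPt, eval_basicPoly, basicInv_nilPt] at h8 h10
  simp at h8 h10
  tauto

section Relations

variable {K : Type*} [CommRing K]

lemma polarDisc_comm (u v : Fin 3 → K) : polarDisc u v = polarDisc v u := by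
  simp only [polarDisc]; ring

lemma polarDisc_quarticOp_left (s : Fin 5 → K) (u v : Fin 3 → K) :
    polarDisc (quarticOp s u) v = polarDisc u (quarticOp s v) := by
  simp [polarDisc, quarticOp]; ring

lemma polarDisc_quarticOp_cube (s : Fin 5 → K) (u v : Fin 3 → K) :
    polarDisc u (quarticOp s (quarticOp s (quarticOp s v)))
      = 12 * quarticI s * polarDisc u (quarticOp s v) + quarticJ s * polarDisc u v := by
  simp only [polarDisc, quarticOp_cube]; ring

/-- The square of the determinant is given by the Gram determinant. -/
lemma tripleDet_sq (u v w : Fin 3 → K) :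
    4 * tripleDet u v w ^ 2 = -(polarDisc u u * (polarDisc v v * polarDisc w w - polarDisc v w ^ 2)
      - polarDisc u v * (polarDisc u v * polarDisc w w - polarDisc v w * polarDisc u w)
      + polarDisc u w * (polarDisc u v * polarDisc v w - polarDisc v v * polarDisc u w)) := by
  simp only [polarDisc, tripleDet]; ring

lemma basicInv_rel_six (u v : Fin 3 → K) (s : Fin 5 → K) {z : Fin 19 → K}
    (hz : z = basicInv u v s) :
    -(2 * (z 5 * z 7 - z 6 ^ 2)) - 2 * (z 0 * z 10 + z 2 * z 8 - 2 * z 1 * z 9)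
      + 12 * z 3 * (2 * (z 0 * z 2 - z 1 ^ 2)) = 0 := by
  subst hz
  simp [basicInv, polarDisc, quarticOp, quarticI]; ring

lemma basicInv_rel_seven (u v : Fin 3 → K) (s : Fin 5 → K) {z : Fin 19 → K}
    (hz : z = basicInv u v s) :
    2 * (z 5 * z 10 + z 7 * z 8 - 2 * z 6 * z 9) + z 4 * (2 * (z 0 * z 2 - z 1 ^ 2)) = 0 := by
  subst hz
  simp [basicInv, polarDisc, quarticOp, quarticJ, tripleDet]; ring

lemma basicInv_rel_eight (u v : Fin 3 → K) (s : Fin 5 → K) {z : Fin 19 → K}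
    (hz : z = basicInv u v s) :
    2 * (z 8 * z 10 - z 9 ^ 2) + 12 * z 3 * (2 * (z 5 * z 7 - z 6 ^ 2))
      + 2 * z 4 * (z 0 * z 7 + z 2 * z 5 - 2 * z 1 * z 6) = 0 := by
  subst hz
  simp [basicInv, polarDisc, quarticOp, quarticI, quarticJ, tripleDet]; ring

end Relations

/-- The determinant of a symmetric `3 × 3` matrix. -/
def symmDet {K : Type*} [CommRing K] (a b c d e f : K) : K :=
  a * (d * f - e ^ 2) - b * (b * f - e * c) + c * (b * e - d * c)

lemma map_symmDet {K L F : Type*} [CommRing K] [CommRing L] [FunLike F K L] [RingHomClass F K L]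
    (φ : F) (a b c d e f : K) :
    φ (symmDet a b c d e f) = symmDet (φ a) (φ b) (φ c) (φ d) (φ e) (φ f) := by
  simp [symmDet]

/-- Gram determinants expressing the squares of the last eight basic invariants. -/
def oddGram {K : Type*} [CommRing K] (z : Fin 19 → K) : Fin 8 → K :=
  ![symmDet (z 0) (z 1) (z 5) (z 2) (z 6) (z 8),
    symmDet (z 0) (z 1) (z 6) (z 2) (z 7) (z 10),
    symmDet (z 0) (z 1) (z 8) (z 2) (z 9) (12 * z 3 * z 8 + z 4 * z 5),
    symmDet (z 0) (z 1) (z 9) (z 2) (z 10) (12 * z 3 * z 10 + z 4 * z 7),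
    symmDet (z 0) (z 5) (z 8) (z 8) (12 * z 3 * z 5 + z 4 * z 0) (12 * z 3 * z 8 + z 4 * z 5),
    symmDet (z 2) (z 6) (z 9) (z 8) (12 * z 3 * z 5 + z 4 * z 0) (12 * z 3 * z 8 + z 4 * z 5),
    symmDet (z 0) (z 6) (z 9) (z 10) (12 * z 3 * z 7 + z 4 * z 2) (12 * z 3 * z 10 + z 4 * z 7),
    symmDet (z 2) (z 7) (z 10) (z 10) (12 * z 3 * z 7 + z 4 * z 2)
      (12 * z 3 * z 10 + z 4 * z 7)]

lemma basicInv_odd_sq {K : Type*} [CommRing K] (u v : Fin 3 → K) (s : Fin 5 → K) {z : Fin 19 → K}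
    (hz : z = basicInv u v s) (k : Fin 8) :
    4 * z (Fin.natAdd 11 k) ^ 2 = -oddGram z k := by
  have h0 : polarDisc v u = polarDisc u v := polarDisc_comm _ _
  have h1 : polarDisc v (quarticOp s u) = polarDisc u (quarticOp s v) := by
    rw [polarDisc_comm, polarDisc_quarticOp_left]
  have h2 : polarDisc v (quarticOp s (quarticOp s u))
      = polarDisc u (quarticOp s (quarticOp s v)) := by
    rw [polarDisc_comm, polarDisc_quarticOp_left, polarDisc_quarticOp_left]
  have hg : ∀ a b c : Fin 3 → K, 4 * tripleDet a b c ^ 2 = -symmDet (polarDisc a a)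
      (polarDisc a b) (polarDisc a c) (polarDisc b b) (polarDisc b c) (polarDisc c c) :=
    fun a b c => by rw [tripleDet_sq, symmDet]
  subst hz
  fin_cases k
  all_goals
    refine (hg _ _ _).trans ?_
    simp only [polarDisc_quarticOp_left, polarDisc_quarticOp_cube, h1, h2]
    simp [oddGram, basicInv, polarDisc_quarticOp_left]

section Reduced

variable {Q : Type*} [CommRing Q] [IsReduced Q] [Algebra ℂ Q]

omit [IsReduced Q] in
lemma eq_zero_of_natCast_mul {n : ℕ} (hn : n ≠ 0) {x : Q} (h : (n : Q) * x = 0) : x = 0 := by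
  have h1 : algebraMap ℂ Q ((n : ℂ)⁻¹) * (n : Q) = 1 := by
    rw [← map_natCast (algebraMap ℂ Q) n, ← map_mul, inv_mul_cancel₀ (by exact_mod_cast hn),
      map_one]
  rw [← one_mul x, ← h1, mul_assoc, h, mul_zero]

/-- The images of the parameters under a homomorphism. -/
def paramVal (z : Fin 19 → Q) : Fin 8 → Q :=
  ![z 0, z 2, z 3, z 4, z 5, z 7, z 8 + z 10, z 9 + z 1 ^ 2]


lemma eq_zero_of_paramVal {ψ : MvPolynomial (Fin 19) ℂ →ₐ[ℂ] Q}
    (hψ : ∀ Y, aeval basicPoly Y = 0 → ψ Y = 0)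
    (hp : ∀ j, paramVal (fun i => ψ (X i)) j = 0) (i : Fin 19) : ψ (X i) = 0 := by
  have hrel : ∀ Y : MvPolynomial (Fin 19) ℂ, (∀ u v s, eval (basicInv u v s) Y = 0) → ψ Y = 0 := by
    intro Y hY
    refine hψ Y (funext_mkPt fun u v s => ?_)
    rw [eval_aeval, map_zero]
    simpa only [eval_basicPoly] using hY u v s
  have h6 := hrel (-(2 * (X 5 * X 7 - X 6 ^ 2)) - 2 * (X 0 * X 10 + X 2 * X 8 - 2 * X 1 * X 9)
      + 12 * X 3 * (2 * (X 0 * X 2 - X 1 ^ 2)))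
    fun u v s => by simpa using basicInv_rel_six u v s rfl
  have h7 := hrel (2 * (X 5 * X 10 + X 7 * X 8 - 2 * X 6 * X 9)
      + X 4 * (2 * (X 0 * X 2 - X 1 ^ 2)))
    fun u v s => by simpa using basicInv_rel_seven u v s rfl
  have h8 := hrel (2 * (X 8 * X 10 - X 9 ^ 2) + 12 * X 3 * (2 * (X 5 * X 7 - X 6 ^ 2))
      + 2 * X 4 * (X 0 * X 7 + X 2 * X 5 - 2 * X 1 * X 6))
    fun u v s => by simpa using basicInv_rel_eight u v s rfl
  have hodd : ∀ k, ψ (4 * X (Fin.natAdd 11 k) ^ 2 + oddGram X k) = 0 := fun k => by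
    refine hrel _ fun u v s => ?_
    have hm : eval (basicInv u v s) (oddGram X k) = oddGram (basicInv u v s) k := by
      fin_cases k <;> simp [oddGram, map_symmDet]
    have := basicInv_odd_sq u v s rfl k
    simp [hm, this]
  have hm : ∀ k, ψ (oddGram X k) = oddGram (fun i => ψ (X i)) k := fun k => by
    fin_cases k <;> simp [oddGram, map_symmDet, map_ofNat ψ 12]
  simp only [map_add, map_sub, map_mul, map_neg, map_pow, map_ofNat, hm] at h6 h7 h8 hodd
  set z : Fin 19 → Q := fun i => ψ (X i) with hz
  change z i = 0
  have e0 : z 0 = 0 := hp 0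
  have e2 : z 2 = 0 := hp 1
  have e3 : z 3 = 0 := hp 2
  have e4 : z 4 = 0 := hp 3
  have e5 : z 5 = 0 := hp 4
  have e7 : z 7 = 0 := hp 5
  have e10 : z 10 = -z 8 := (neg_eq_of_add_eq_zero_right (hp 6)).symm
  have e9 : z 9 = -z 1 ^ 2 := eq_neg_of_add_eq_zero_left (hp 7)
  change -(2 * (z 5 * z 7 - z 6 ^ 2)) - 2 * (z 0 * z 10 + z 2 * z 8 - 2 * z 1 * z 9)
      + 12 * z 3 * (2 * (z 0 * z 2 - z 1 ^ 2)) = 0 at h6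
  change 2 * (z 5 * z 10 + z 7 * z 8 - 2 * z 6 * z 9) + z 4 * (2 * (z 0 * z 2 - z 1 ^ 2)) = 0 at h7
  change 2 * (z 8 * z 10 - z 9 ^ 2) + 12 * z 3 * (2 * (z 5 * z 7 - z 6 ^ 2))
      + 2 * z 4 * (z 0 * z 7 + z 2 * z 5 - 2 * z 1 * z 6) = 0 at h8
  simp only [e0, e2, e3, e4, e5, e7, e9, e10] at h6 h7 h8
  have e6 : z 6 * z 1 ^ 2 = 0 :=
    eq_zero_of_natCast_mul (n := 4) (by norm_num) (by push_cast; linear_combination h7)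
  have e1 : z 1 = 0 := by
    refine IsReduced.eq_zero _ ⟨5, eq_zero_of_natCast_mul (n := 4) (by norm_num) ?_⟩
    push_cast
    linear_combination -z 1 ^ 2 * h6 + 2 * z 6 * e6
  have e6 : z 6 = 0 := by
    refine IsReduced.eq_zero _ ⟨2, eq_zero_of_natCast_mul (n := 2) (by norm_num) ?_⟩
    rw [e1] at h6
    push_cast
    linear_combination h6
  have e8 : z 8 = 0 := by
    refine IsReduced.eq_zero _ ⟨2, eq_zero_of_natCast_mul (n := 2) (by norm_num) ?_⟩
    rw [e1] at h8
    push_cast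
    linear_combination -h8
  have e9 : z 9 = 0 := by rw [e9, e1]; simp
  have e10 : z 10 = 0 := by rw [e10, e8]; simp
  have e11 : ∀ k : Fin 8, z (Fin.natAdd 11 k) = 0 := by
    intro k
    refine IsReduced.eq_zero _ ⟨2, eq_zero_of_natCast_mul (n := 4) (by norm_num) ?_⟩
    have := hodd k
    rw [show oddGram z k = 0 by
      fin_cases k <;> simp [oddGram, symmDet, e0, e1, e2, e3, e4, e5, e6, e7, e8, e9, e10]] at this
    push_cast
    rwa [add_zero] at this
  fin_cases i
  exacts [e0, e1, e2, e3, e4, e5, e6, e7, e8, e9, e10, e11 0, e11 1, e11 2, e11 3, e11 4, e11 5,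
    e11 6, e11 7]

end Reduced

lemma weightedHomogeneousComponent_mul_left_of_lt {σ : Type*} {w : σ → ℕ} {D : MvPolynomial σ ℂ}
    {d n : ℕ} (hD : IsWeightedHomogeneous w D d) (hn : n < d) (Q : MvPolynomial σ ℂ) :
    weightedHomogeneousComponent w n (D * Q) = 0 := by
  induction Q using MvPolynomial.induction_on' with
  | add p q hp hq => rw [mul_add, map_add, hp, hq, add_zero]
  | monomial β r =>
    exact (hD.mul (isWeightedHomogeneous_monomial w β r rfl)).weightedHomogeneousComponent_ne _
      (by omega)

/-- The eight parameters. -/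
def paramPoly : Fin 8 → MvPolynomial (Idx degs) ℂ := paramVal basicPoly

/-- The degrees of the eight parameters. -/
abbrev paramDeg : Fin 8 → ℕ := ![2, 2, 2, 3, 3, 3, 4, 4]

lemma map_paramVal {K L F : Type*} [CommRing K] [CommRing L] [FunLike F K L] [RingHomClass F K L]
    (φ : F) (z : Fin 19 → K) (j : Fin 8) : φ (paramVal z j) = paramVal (fun i => φ (z i)) j := by
  fin_cases j <;> simp [paramVal]

lemma aeval_paramVal_X (j : Fin 8) :
    aeval basicPoly (paramVal (X : Fin 19 → MvPolynomial (Fin 19) ℂ) j) = paramPoly j := by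
  rw [map_paramVal]
  simp only [aeval_X, paramPoly]

lemma paramPoly_mem (j : Fin 8) : paramPoly j ∈ invariantRing degs := by
  rw [← basicAlg_eq]
  exact ⟨_, aeval_paramVal_X j⟩

lemma paramVal_isHomogeneous {σ : Type*} {z : Fin 19 → MvPolynomial σ ℂ}
    (h : ∀ i, (z i).IsHomogeneous (totDeg i)) (j : Fin 8) :
    (paramVal z j).IsHomogeneous (paramDeg j) := by
  have h6 : (z 8 + z 10).IsHomogeneous 4 := IsHomogeneous.add (h 8) (h 10)
  have h7 : (z 9 + z 1 ^ 2).IsHomogeneous 4 :=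
    IsHomogeneous.add (h 9) (IsHomogeneous.pow (h 1) 2)
  fin_cases j
  exacts [h 0, h 2, h 3, h 4, h 5, h 7, h6, h7]

lemma paramPoly_isHomogeneous (j : Fin 8) : (paramPoly j).IsHomogeneous (paramDeg j) :=
  paramVal_isHomogeneous basicPoly_isHomogeneous_totDeg j

lemma exists_pow_basicPoly (i : Fin 19) : ∃ (N : ℕ) (G : Fin 8 → MvPolynomial (Fin 19) ℂ),
    basicPoly i ^ (N + 1) = ∑ j, paramPoly j * aeval basicPoly (G j) := by
  let J : Ideal (MvPolynomial (Fin 19) ℂ) :=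
    Ideal.span (Set.range (paramVal X)) ⊔ RingHom.ker (aeval basicPoly :
      MvPolynomial (Fin 19) ℂ →ₐ[ℂ] MvPolynomial (Idx degs) ℂ)
  have : IsReduced (MvPolynomial (Fin 19) ℂ ⧸ J.radical) :=
    (Ideal.isRadical_iff_quotient_reduced _).mp (Ideal.radical_isRadical J)
  have h0 : Ideal.Quotient.mkₐ ℂ J.radical (X i) = 0 := by
    refine eq_zero_of_paramVal (fun Y hY => ?_) (fun j => ?_) i
    · refine Ideal.Quotient.eq_zero_iff_mem.mpr (Ideal.le_radical ?_)
      exact (le_sup_right : _ ≤ J) hY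
    · rw [← map_paramVal]
      refine Ideal.Quotient.eq_zero_iff_mem.mpr (Ideal.le_radical ?_)
      exact (le_sup_left : _ ≤ J) (Ideal.subset_span ⟨j, rfl⟩)
  obtain ⟨N, hN⟩ := Ideal.Quotient.eq_zero_iff_mem.mp h0
  have hN1 : X i ^ (N + 1) ∈ J := by rw [pow_succ]; exact J.mul_mem_right _ hN
  obtain ⟨a, ha, b, hb, hab⟩ := Submodule.mem_sup.mp hN1
  obtain ⟨G, rfl⟩ := (Ideal.mem_span_range_iff_exists_fun).mp ha
  refine ⟨N, G, ?_⟩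
  have := congrArg (aeval basicPoly) hab
  rw [map_add, (RingHom.mem_ker).mp hb, add_zero, map_sum, map_pow, aeval_X] at this
  rw [← this]
  refine Finset.sum_congr rfl fun j _ => ?_
  rw [map_mul, aeval_paramVal_X, mul_comm]

lemma isIntegral_of_mem_invariantRing {x : MvPolynomial (Idx degs) ℂ}
    (hx : x ∈ invariantRing degs) : IsIntegral (Algebra.adjoin ℂ (Set.range paramPoly)) x := by
  set A := Algebra.adjoin ℂ (Set.range paramPoly) with hA
  choose N G hG using exists_pow_basicPoly
  let M : Submodule A (MvPolynomial (Idx degs) ℂ) :=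
    Submodule.span A (Set.range fun β : (i : Fin 19) → Fin (N i + 1) =>
      ∏ i, basicPoly i ^ (β i : ℕ))
  have hC : ∀ (r : ℂ) {m}, m ∈ M → C r * m ∈ M := fun r m hm =>
    M.smul_mem ⟨C r, A.algebraMap_mem r⟩ hm
  have hPM : ∀ j {m}, m ∈ M → paramPoly j * m ∈ M := fun j m hm =>
    M.smul_mem ⟨paramPoly j, Algebra.subset_adjoin ⟨j, rfl⟩⟩ hm
  have hmon : ∀ (β : Fin 19 →₀ ℕ) (r : ℂ),
      aeval basicPoly (monomial β r) = C r * ∏ i, basicPoly i ^ β i := fun β r => by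
    rw [aeval_monomial, algebraMap_eq, Finsupp.prod_fintype _ _ (by simp)]
  have key : ∀ n, ∀ Y : MvPolynomial (Fin 19) ℂ, IsWeightedHomogeneous totDeg Y n →
      aeval basicPoly Y ∈ M := by
    intro n
    induction n using Nat.strong_induction_on with
    | _ n ih =>
    intro Y hY
    rw [Y.as_sum, map_sum]
    refine sum_mem fun β hβ => ?_
    have hw : Finsupp.weight totDeg β = n := hY (mem_support_iff.mp hβ)
    rw [hmon]
    refine hC _ ?_
    by_cases hlt : ∀ i, β i < N i + 1
    · exact Submodule.subset_span ⟨fun i => ⟨β i, hlt i⟩, rfl⟩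
    · push Not at hlt
      obtain ⟨i, hi⟩ := hlt
      obtain ⟨γ, rfl⟩ := exists_add_of_le (Finsupp.single_le_iff.mpr hi)
      have h1 : ∏ k, basicPoly k ^ (Finsupp.single i (N i + 1) + γ) k
          = ∑ j, paramPoly j * aeval basicPoly (G i j * monomial γ 1) := by
        have e1 : ∏ k, basicPoly k ^ (Finsupp.single i (N i + 1)) k = basicPoly i ^ (N i + 1) := by
          rw [Finset.prod_eq_single i (fun k _ hk => by simp [Finsupp.single_eq_of_ne hk])
            (by simp), Finsupp.single_eq_same]
        have e2 := hmon γ 1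
        rw [C_1, one_mul] at e2
        simp only [Finsupp.add_apply, pow_add, Finset.prod_mul_distrib]
        rw [e1, ← e2, hG, Finset.sum_mul]
        exact Finset.sum_congr rfl fun j _ => by rw [map_mul, mul_assoc]
      have h2 : IsWeightedHomogeneous (1 : Idx degs → ℕ)
          (∏ k, basicPoly k ^ (Finsupp.single i (N i + 1) + γ) k) n := by
        have := isWeightedHomogeneous_aeval_monomial (w := (1 : Idx degs → ℕ))
          basicPoly_isHomogeneous_totDeg (Finsupp.single i (N i + 1) + γ) 1
        rwa [hw, hmon, C_1, one_mul] at this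
      rw [← h2.weightedHomogeneousComponent_same, h1, map_sum]
      refine sum_mem fun j _ => ?_
      have hPj : IsWeightedHomogeneous (1 : Idx degs → ℕ) (paramPoly j) (paramDeg j) :=
        paramPoly_isHomogeneous j
      rcases lt_or_ge n (paramDeg j) with hj | hj
      · rw [weightedHomogeneousComponent_mul_left_of_lt hPj hj]
        exact zero_mem _
      · obtain ⟨m, rfl⟩ := exists_add_of_le hj
        rw [weightedHomogeneousComponent_mul_left hPj,
          weightedHomogeneousComponent_aeval (w := (1 : Idx degs → ℕ)) (d := totDeg)
            basicPoly_isHomogeneous_totDeg]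
        refine hPM j (ih m ?_ _ (weightedHomogeneousComponent_isWeightedHomogeneous _ _))
        have : 0 < paramDeg j := by fin_cases j <;> simp
        omega
  have hRM : ∀ y ∈ invariantRing degs, y ∈ M := by
    intro y hy
    rw [← basicAlg_eq] at hy
    obtain ⟨Y, rfl⟩ := hy
    change aeval basicPoly Y ∈ M
    rw [Y.as_sum, map_sum]
    exact sum_mem fun β _ => key _ _ (isWeightedHomogeneous_monomial _ _ _ rfl)
  have hAR : A ≤ invariantRing degs := Algebra.adjoin_le (by
    rintro _ ⟨j, rfl⟩; exact paramPoly_mem j)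
  have hMR : ∀ y ∈ M, y ∈ invariantRing degs := by
    intro y hy
    induction hy using Submodule.span_induction with
    | mem y hy =>
      obtain ⟨β, rfl⟩ := hy
      exact prod_mem fun i _ => pow_mem (basicPoly_mem i) _
    | zero => exact zero_mem _
    | add y z _ _ hy hz => exact add_mem hy hz
    | smul a y _ hy => exact mul_mem (hAR a.2) hy
  refine isIntegral_of_smul_mem_submodule M ?_ (Submodule.fg_span (Set.finite_range _)) x
    fun m hm => hRM _ (mul_mem hx (hMR m hm))
  rw [Submodule.ne_bot_iff]
  exact ⟨1, hRM 1 (one_mem _), one_ne_zero⟩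

section Slice

/-- A slice: the pairs of quadratics and the quartics `p x⁴ + q x² y² + p y⁴`. -/
def slicePt : Idx degs → MvPolynomial (Fin 8) ℂ :=
  mkPt ![X 0 + X 1, X 2, X 0 - X 1] ![X 3 + X 4, X 5, X 3 - X 4] ![X 6, 0, X 7, 0, X 6]

/-- The algebra generated by the restrictions of the parameters to the slice. -/
abbrev sliceAlg : Subalgebra ℂ (MvPolynomial (Fin 8) ℂ) :=
  Algebra.adjoin ℂ (Set.range fun j => aeval slicePt (paramPoly j))

lemma isIntegral_slice (i : Fin 19) : IsIntegral sliceAlg (aeval slicePt (basicPoly i)) := by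
  let f : MvPolynomial (Idx degs) ℂ →ₐ[ℂ] MvPolynomial (Fin 8) ℂ := aeval slicePt
  have hle : Algebra.adjoin ℂ (Set.range paramPoly) ≤ sliceAlg.comap f := by
    refine Algebra.adjoin_le ?_
    rintro _ ⟨j, rfl⟩
    exact Algebra.subset_adjoin ⟨j, rfl⟩
  have h := isIntegral_of_mem_invariantRing (basicPoly_mem i)
  let φ : Algebra.adjoin ℂ (Set.range paramPoly) →+* sliceAlg :=
    ((f.comp (Subalgebra.val _)).codRestrict sliceAlg fun x => hle x.2).toRingHom
  exact IsIntegral.map_of_comp_eq φ f.toRingHom (RingHom.ext fun _ => rfl) h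

lemma isAlgebraic_of_cube_eq {R S : Type*} [CommRing R] [Nontrivial R] [CommRing S] [Algebra R S]
    {x : S} (a b : R) (h : x ^ 3 = algebraMap R S a * x + algebraMap R S b) :
    IsAlgebraic R x := by
  have hm : (Polynomial.X ^ 3 - (Polynomial.C a * Polynomial.X + Polynomial.C b)).Monic :=
    Polynomial.monic_X_pow_sub (n := 3)
      (Polynomial.degree_linear_le.trans_lt (by norm_num))
  exact ⟨_, hm.ne_zero, by simp [h]⟩

lemma isAlgebraic_slice_X (k : Fin 8) : IsAlgebraic sliceAlg (X k : MvPolynomial (Fin 8) ℂ) := by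
  let L := Subalgebra.algebraicClosure sliceAlg (MvPolynomial (Fin 8) ℂ)
  have hN : ∀ (m : ℕ) [m.AtLeastTwo], (OfNat.ofNat m : MvPolynomial (Fin 8) ℂ) ∈ L :=
    fun m _ => ofNat_mem L m
  have hz : ∀ i, basicInv ![X 0 + X 1, X 2, X 0 - X 1] ![X 3 + X 4, X 5, X 3 - X 4]
      ![X 6, 0, X 7, 0, X 6] i ∈ L := fun i => by
    rw [← aeval_basicPoly]
    exact (isIntegral_slice i).isAlgebraic
  have h3 : (12 * X 6 ^ 2 + X 7 ^ 2 : MvPolynomial (Fin 8) ℂ) ∈ sliceAlg := by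
    refine Algebra.subset_adjoin ⟨2, ?_⟩
    simp only [paramPoly, map_paramVal, slicePt, aeval_basicPoly]
    simp [paramVal, basicInv, quarticI]; ring
  have h4 : ((2 * X 7 + 12 * X 6) * (2 * X 7 - 12 * X 6) * (-4 * X 7) : MvPolynomial (Fin 8) ℂ)
      ∈ sliceAlg := by
    refine Algebra.subset_adjoin ⟨3, ?_⟩
    simp only [paramPoly, map_paramVal, slicePt, aeval_basicPoly]
    simp [paramVal, basicInv, quarticJ, tripleDet, quarticOp]; ring
  have hroot : ∀ c : MvPolynomial (Fin 8) ℂ, c ^ 3 = 12 * (12 * X 6 ^ 2 + X 7 ^ 2) * c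
      + (2 * X 7 + 12 * X 6) * (2 * X 7 - 12 * X 6) * (-4 * X 7) → c ∈ L := fun c hc =>
    isAlgebraic_of_cube_eq (12 * ⟨_, h3⟩) ⟨_, h4⟩ (by rw [hc, map_mul, map_ofNat]; rfl)
  have ha : 2 * X 7 + 12 * X 6 ∈ L := hroot _ (by ring)
  have hb : 2 * X 7 - 12 * X 6 ∈ L := hroot _ (by ring)
  have hc : -4 * X 7 ∈ L := hroot _ (by ring)
  have hdiv : ∀ (d x : MvPolynomial (Fin 8) ℂ), d ∈ L → d ≠ 0 → d * x ∈ L → x ∈ L :=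
    fun d x hd h0 h => IsAlgebraic.of_mul (mem_nonZeroDivisors_of_ne_zero h0) hd h
  have hne : ∀ d : MvPolynomial (Fin 8) ℂ, eval (fun i => if i = 6 then 1 else 0) d ≠ 0 → d ≠ 0 :=
    fun d h h0 => h (by rw [h0, map_zero])
  have hkey : ∀ (l m n x y w : MvPolynomial (Fin 8) ℂ), l ∈ L → m ∈ L → n ∈ L → l ≠ m → l ≠ n →
      x + y + w ∈ L → l * x + m * y + n * w ∈ L → l ^ 2 * x + m ^ 2 * y + n ^ 2 * w ∈ L →
      x ∈ L := by
    intro l m n x y w hl hm hn hlm hln e0 e1 e2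
    refine hdiv ((l - m) * (l - n)) x (mul_mem (sub_mem hl hm) (sub_mem hl hn))
      (mul_ne_zero (sub_ne_zero.mpr hlm) (sub_ne_zero.mpr hln)) ?_
    have := add_mem (sub_mem e2 (mul_mem (add_mem hm hn) e1)) (mul_mem (mul_mem hm hn) e0)
    convert this using 1
    ring
  have hab : (2 * X 7 + 12 * X 6 : MvPolynomial (Fin 8) ℂ) ≠ 2 * X 7 - 12 * X 6 :=
    sub_ne_zero.mp (hne _ (by simp))
  have hac : (2 * X 7 + 12 * X 6 : MvPolynomial (Fin 8) ℂ) ≠ -4 * X 7 :=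
    sub_ne_zero.mp (hne _ (by simp))
  have hbc : (2 * X 7 - 12 * X 6 : MvPolynomial (Fin 8) ℂ) ≠ -4 * X 7 :=
    sub_ne_zero.mp (hne _ (by simp))
  have hsq : ∀ x : MvPolynomial (Fin 8) ℂ, x ^ 2 ∈ L → x ∈ L :=
    fun x h => IsAlgebraic.of_pow two_pos h
  have hq4 : ∀ x : MvPolynomial (Fin 8) ℂ, 4 * x ^ 2 ∈ L → x ∈ L := fun x h =>
    hsq x (hdiv 4 _ (hN 4) (OfNat.ofNat_ne_zero 4) h)
  have hquad : ∀ x y w : MvPolynomial (Fin 8) ℂ,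
      w ^ 2 - 4 * x ^ 2 + 4 * y ^ 2 ∈ L →
      -4 * X 7 * w ^ 2 - 4 * (2 * X 7 + 12 * X 6) * x ^ 2 + 4 * (2 * X 7 - 12 * X 6) * y ^ 2 ∈ L →
      (-4 * X 7) ^ 2 * w ^ 2 - 4 * (2 * X 7 + 12 * X 6) ^ 2 * x ^ 2
        + 4 * (2 * X 7 - 12 * X 6) ^ 2 * y ^ 2 ∈ L → x ∈ L ∧ y ∈ L ∧ w ∈ L := by
    intro x y w e0 e1 e2
    refine ⟨hq4 _ ?_, hq4 _ ?_, hsq _ ?_⟩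
    · rw [← neg_mem_iff]
      refine hkey _ _ _ _ (4 * y ^ 2) (w ^ 2) ha hb hc hab hac ?_ ?_ ?_
      exacts [by convert e0 using 1; ring, by convert e1 using 1; ring, by convert e2 using 1; ring]
    · refine hkey _ _ _ _ (-(4 * x ^ 2)) (w ^ 2) hb ha hc hab.symm hbc ?_ ?_ ?_
      exacts [by convert e0 using 1; ring, by convert e1 using 1; ring, by convert e2 using 1; ring]
    · refine hkey _ _ _ _ (-(4 * x ^ 2)) (4 * y ^ 2) hc ha hb hac.symm hbc.symm ?_ ?_ ?_
      exacts [by convert e0 using 1; ring, by convert e1 using 1; ring, by convert e2 using 1; ring]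
  have hu := hquad (X 0) (X 1) (X 2)
    (by convert hz 0 using 1; simp [basicInv, polarDisc]; ring)
    (by convert hz 5 using 1; simp [basicInv, polarDisc, quarticOp]; ring)
    (by convert hz 8 using 1; simp [basicInv, polarDisc, quarticOp]; ring)
  have hv := hquad (X 3) (X 4) (X 5)
    (by convert hz 2 using 1; simp [basicInv, polarDisc]; ring)
    (by convert hz 7 using 1; simp [basicInv, polarDisc, quarticOp]; ring)
    (by convert hz 10 using 1; simp [basicInv, polarDisc, quarticOp]; ring)
  have h7 : X 7 ∈ L := hdiv (-4) _ (neg_mem (hN 4)) (neg_ne_zero.mpr (OfNat.ofNat_ne_zero 4)) hc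
  have h6 : X 6 ∈ L := hdiv 12 _ (hN 12) (OfNat.ofNat_ne_zero 12)
    (by simpa using sub_mem ha (mul_mem (hN 2) h7))
  change X k ∈ L
  fin_cases k
  exacts [hu.1, hu.2.1, hu.2.2, hv.1, hv.2.1, hv.2.2, h6, h7]

lemma algebraicIndependent_paramPoly : AlgebraicIndependent ℂ paramPoly := by
  let x : Fin 8 → MvPolynomial (Fin 8) ℂ := fun j => aeval slicePt (paramPoly j)
  have halg : Algebra.IsAlgebraic (Algebra.adjoin ℂ (Set.range x)) (MvPolynomial (Fin 8) ℂ) := by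
    refine ⟨fun P => ?_⟩
    change P ∈ Subalgebra.algebraicClosure sliceAlg (MvPolynomial (Fin 8) ℂ)
    induction P using MvPolynomial.induction_on with
    | C r => exact Subalgebra.algebraMap_mem _ (⟨C r, sliceAlg.algebraMap_mem r⟩ : sliceAlg)
    | add P Q hP hQ => exact add_mem hP hQ
    | mul_X P k hP => exact mul_mem hP (isAlgebraic_slice_X k)
  have hx := Algebra.IsAlgebraic.isTranscendenceBasis_of_le_trdeg_of_finite ℂ x
    (by rw [MvPolynomial.trdeg_of_isDomain, Cardinal.lift_id])
  exact AlgebraicIndependent.of_comp (aeval slicePt) hx.1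

lemma isHSOP_paramPoly : IsHSOP degs paramPoly paramDeg :=
  ⟨paramPoly_mem, fun j => by fin_cases j <;> simp, paramPoly_isHomogeneous,
    algebraicIndependent_paramPoly, fun _ hx => isIntegral_of_mem_invariantRing hx⟩

end Slice

end BinInv

end

open BinInv in
/-- For `V = 2V₂ ⊕ V₄`: there is a homogeneous system of parameters of degrees
`2, 2, 2, 3, 3, 3, 4, 4`; the minimal number of generators is `19`, with degrees
`2, 2, 2, 2, 3, 3, 3, 3, 4, 4, 4, 4, 4, 5, 5, 6, 6, 6, 6`; and there is no
homogeneous system of parameters of degrees `2, 2, 2, 2, 3, 3, 3, 4`. -/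
theorem twoV2_V4_hsop_and_generators :
    (∃ P : Fin 8 → MvPolynomial (Idx ![2, 2, 4]) ℂ,
      IsHSOP ![2, 2, 4] P ![2, 2, 2, 3, 3, 3, 4, 4]) ∧
    HasMinimalGens ![2, 2, 4]
      ![2, 2, 2, 2, 3, 3, 3, 3, 4, 4, 4, 4, 4, 5, 5, 6, 6, 6, 6] ∧
    ¬ ∃ P : Fin 8 → MvPolynomial (Idx ![2, 2, 4]) ℂ,
      IsHSOP ![2, 2, 4] P ![2, 2, 2, 2, 3, 3, 3, 4] := by
  exact ⟨⟨paramPoly, isHSOP_paramPoly⟩, hasMinimalGens_degs, not_isHSOP_degs⟩
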